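/- arXiv:2304.09274 — 3 statements merged into one kernel-verified Lean document; each statement's English description precedes it below -/
import Mathlib

section
/- Discrete-time I-MMSE relationship for the additive white Gaussian channel with feedback (Theorem 2.4, feedback case): Let M be a random element of a standard Borel space, and let W_0, …, W_n be random vectors on ℝ^s such that each W_i is standard Gaussian and independent of (M, W_0, …, W_{i−1}). Define recursively Y_i = φ_i(M, Y_0, …, Y_{i−1}) + W_i for measurable maps φ_i, and set Φ_i := φ_i(M, Y_0, …, Y_{i−1}), assuming E[‖Φ_i‖²] < ∞ for every i. Then (1/2)·∑_{i=0}^{n} cmmse(Φ_i) ≤ I(M; (Y_0, …, Y_n)) ≤ (1/2)·∑_{i=0}^{n} pmmse(Φ_i). -/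
open MeasureTheory ProbabilityTheory Filter Classical

noncomputable section

/-- Squared Euclidean norm of a finite real vector. -/
def sqNorm {d : ℕ} (v : Fin d → ℝ) : ℝ := ∑ k, (v k) ^ 2

/-- Standard Gaussian measure on `ℝ^d` (i.i.d. standard normal coordinates). -/
def stdGaussian (d : ℕ) : Measure (Fin d → ℝ) :=
  Measure.pi fun _ => gaussianReal 0 1

/-- Mutual information between random elements `X` and `Y`: the Kullback–Leibler divergence
between the law of the pair and the product of the marginal laws (`⊤` if the divergence
is not a well-defined finite integral). -/
def mutualInfo {Ω α β : Type*} [MeasurableSpace Ω] [MeasurableSpace α] [MeasurableSpace β]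
    (μ : Measure Ω) (X : Ω → α) (Y : Ω → β) : EReal :=
  let π : Measure (α × β) := μ.map fun ω => (X ω, Y ω)
  let ρ : Measure (α × β) := (μ.map X).prod (μ.map Y)
  if π ≪ ρ ∧ Integrable (llr π ρ) π then ((∫ p, llr π ρ p ∂π : ℝ) : EReal) else ⊤

/-- σ-algebra generated by the `Y j` with `(j : ℕ) < i`. -/
def pastSigmaF {Ω β : Type*} [MeasurableSpace Ω] [MeasurableSpace β] {n : ℕ}
    (Y : Fin n → Ω → β) (i : ℕ) : MeasurableSpace Ω :=
  ⨆ j : {j : Fin n // (j : ℕ) < i}, MeasurableSpace.comap (Y j) inferInstance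

/-- Causal MMSE of `U` given `Y_0, …, Y_i`. -/
def cmmseF {Ω : Type*} [MeasurableSpace Ω] {s n : ℕ} (μ : Measure Ω)
    (Y : Fin n → Ω → (Fin s → ℝ)) (U : Ω → (Fin s → ℝ)) (i : ℕ) : ℝ :=
  ∫ ω, sqNorm (U ω - (μ[U | pastSigmaF Y (i + 1)]) ω) ∂μ

/-- Predicted (one-step) MMSE of `U` given `Y_0, …, Y_{i-1}` (the trivial σ-algebra when
`i = 0`). -/
def pmmseF {Ω : Type*} [MeasurableSpace Ω] {s n : ℕ} (μ : Measure Ω)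
    (Y : Fin n → Ω → (Fin s → ℝ)) (U : Ω → (Fin s → ℝ)) (i : ℕ) : ℝ :=
  ∫ ω, sqNorm (U ω - (μ[U | pastSigmaF Y i]) ω) ∂μ

/-- The density at `z` of the standard Gaussian measure translated by `x`, with respect to the
standard Gaussian measure. -/
def gaussTilt {s : ℕ} (x z : Fin s → ℝ) : ℝ := Real.exp (∑ k, (x k * z k - x k ^ 2 / 2))

section Gaussian

variable {s : ℕ}

instance : IsProbabilityMeasure (_root_.stdGaussian s) := by
  unfold _root_.stdGaussian; infer_instance

lemma gaussTilt_pos (x z : Fin s → ℝ) : 0 < gaussTilt x z := Real.exp_pos _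

@[fun_prop]
lemma Measurable.gaussTilt {β : Type*} [MeasurableSpace β] {f g : β → Fin s → ℝ}
    (hf : Measurable f) (hg : Measurable g) : Measurable fun b => gaussTilt (f b) (g b) := by
  unfold _root_.gaussTilt; fun_prop

lemma gaussianReal_eq_withDensity_exp (a : ℝ) :
    gaussianReal a 1
      = (gaussianReal 0 1).withDensity fun z => ENNReal.ofReal (Real.exp (a * z - a ^ 2 / 2)) := by
  rw [gaussianReal_of_var_ne_zero _ one_ne_zero, gaussianReal_of_var_ne_zero _ one_ne_zero,
    ← withDensity_mul _ (measurable_gaussianPDF _ _) (by fun_prop)]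
  congr 1
  ext z
  rw [Pi.mul_apply, gaussianPDF, gaussianPDF, ← ENNReal.ofReal_mul (gaussianPDFReal_nonneg _ _ _),
    gaussianPDFReal_def, gaussianPDFReal_def]
  congr 1
  simp only [mul_assoc, ← Real.exp_add]
  congr 3
  simp
  ring

lemma gaussTilt_eq_prod (x z : Fin s → ℝ) :
    gaussTilt x z = ∏ k, Real.exp (x k * z k - x k ^ 2 / 2) := by
  rw [gaussTilt, Real.exp_sum]

lemma integrable_exp_mul_sub_gaussianReal (a : ℝ) :
    Integrable (fun z => Real.exp (a * z - a ^ 2 / 2)) (gaussianReal 0 1) := by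
  simp_rw [Real.exp_sub]
  exact (integrable_exp_mul_gaussianReal a).div_const _

lemma integrable_gaussTilt (x : Fin s → ℝ) : Integrable (gaussTilt x) (_root_.stdGaussian s) := by
  have : gaussTilt x = fun z => ∏ k, Real.exp (x k * z k - x k ^ 2 / 2) :=
    funext fun z => gaussTilt_eq_prod x z
  rw [this]
  exact Integrable.fintype_prod (f := fun k z => Real.exp (x k * z - x k ^ 2 / 2))
    fun k => integrable_exp_mul_sub_gaussianReal (x k)

lemma stdGaussian_map_add (x : Fin s → ℝ) :
    (_root_.stdGaussian s).map (fun z => x + z)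
      = (_root_.stdGaussian s).withDensity fun z => ENNReal.ofReal (gaussTilt x z) := by
  have h1 : (_root_.stdGaussian s).map (fun z => x + z)
      = Measure.pi fun k => gaussianReal (x k) 1 := by
    have := Measure.pi_map_pi (μ := fun _ : Fin s => gaussianReal 0 1)
      (f := fun k z => x k + z) (fun k => by fun_prop)
      (hμ := fun k => by rw [gaussianReal_map_const_add]; infer_instance)
    simp only [gaussianReal_map_const_add, zero_add] at this
    exact this
  rw [h1]
  refine Measure.pi_eq fun t ht => ?_
  rw [withDensity_apply _ (MeasurableSet.univ_pi ht),
    ← ofReal_integral_eq_lintegral_ofReal (integrable_gaussTilt x).integrableOn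
      (Eventually.of_forall fun z => (gaussTilt_pos x z).le)]
  simp_rw [gaussTilt_eq_prod]
  rw [_root_.stdGaussian, Measure.restrict_pi_pi,
    integral_fintype_prod_eq_prod (fun k z => Real.exp (x k * z - x k ^ 2 / 2)),
    ENNReal.ofReal_prod_of_nonneg fun k _ => integral_nonneg fun z => (Real.exp_pos _).le]
  refine Finset.prod_congr rfl fun k _ => ?_
  rw [gaussianReal_eq_withDensity_exp (x k), withDensity_apply _ (ht k),
    ofReal_integral_eq_lintegral_ofReal (integrable_exp_mul_sub_gaussianReal _).integrableOn
      (Eventually.of_forall fun z => (Real.exp_pos _).le)]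

lemma integral_gaussTilt_mul (x : Fin s → ℝ) (F : (Fin s → ℝ) → ℝ) (hF : Measurable F) :
    ∫ z, gaussTilt x z * F z ∂_root_.stdGaussian s = ∫ z, F (x + z) ∂_root_.stdGaussian s := by
  rw [← integral_map (φ := fun z => x + z) (by fun_prop) hF.aestronglyMeasurable,
    stdGaussian_map_add, integral_withDensity_eq_integral_toReal_smul (by fun_prop) (by simp)]
  simp [ENNReal.toReal_ofReal (gaussTilt_pos _ _).le]

lemma integral_gaussTilt (x : Fin s → ℝ) : ∫ z, gaussTilt x z ∂_root_.stdGaussian s = 1 := by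
  simpa using integral_gaussTilt_mul x (fun _ => 1) measurable_const

lemma measurePreserving_eval_stdGaussian (k : Fin s) :
    MeasurePreserving (fun z : Fin s → ℝ => z k) (_root_.stdGaussian s) (gaussianReal 0 1) :=
  measurePreserving_eval (fun _ : Fin s => gaussianReal 0 1) k

lemma integrable_eval_stdGaussian (k : Fin s) :
    Integrable (fun z : Fin s → ℝ => z k) (_root_.stdGaussian s) :=
  (measurePreserving_eval_stdGaussian k).integrable_comp_of_integrable
    ((memLp_id_gaussianReal 1).integrable le_rfl)

lemma integral_eval_stdGaussian (k : Fin s) : ∫ z, z k ∂_root_.stdGaussian s = 0 := by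
  have := integral_map (μ := _root_.stdGaussian s) (φ := fun z : Fin s → ℝ => z k) (f := id)
    (measurable_pi_apply k).aemeasurable aestronglyMeasurable_id
  rw [(measurePreserving_eval_stdGaussian k).map_eq] at this
  simpa using this.symm

lemma integral_gaussTilt_mul_eval (x : Fin s → ℝ) (k : Fin s) :
    ∫ z, gaussTilt x z * z k ∂_root_.stdGaussian s = x k := by
  rw [integral_gaussTilt_mul x (fun z => z k) (by fun_prop)]
  simp only [Pi.add_apply]
  rw [integral_add (by fun_prop) (integrable_eval_stdGaussian k), integral_eval_stdGaussian]
  simp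

lemma integral_exp_sum_mul_stdGaussian (x : Fin s → ℝ) :
    ∫ z, Real.exp (∑ k, x k * z k) ∂_root_.stdGaussian s = Real.exp (∑ k, x k ^ 2 / 2) := by
  have h := integral_gaussTilt x
  simp_rw [gaussTilt, Finset.sum_sub_distrib, Real.exp_sub] at h
  rw [integral_div, div_eq_one_iff_eq (Real.exp_pos _).ne'] at h
  exact h

lemma integrable_exp_mul_sum_abs_stdGaussian (c : ℝ) :
    Integrable (fun z : Fin s → ℝ => Real.exp (c * ∑ k, |z k|)) (_root_.stdGaussian s) := by
  simp_rw [Finset.mul_sum, Real.exp_sum]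
  exact Integrable.fintype_prod (f := fun (_ : Fin s) z => Real.exp (c * |z|)) fun k =>
    integrable_exp_mul_abs (X := id) (integrable_exp_mul_gaussianReal c)
      (integrable_exp_mul_gaussianReal (-c))

lemma measurePreserving_div_sqrt_two_stdGaussian :
    MeasurePreserving (fun p : (Fin s → ℝ) × (Fin s → ℝ) => fun k => (p.1 k + p.2 k) / √2)
      ((_root_.stdGaussian s).prod (_root_.stdGaussian s)) (_root_.stdGaussian s) := by
  have h1 : MeasurePreserving (fun p : ℝ × ℝ => (p.1 + p.2) / √2)
      ((gaussianReal 0 1).prod (gaussianReal 0 1)) (gaussianReal 0 1) := by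
    refine ⟨by fun_prop, ?_⟩
    have : (fun p : ℝ × ℝ => (p.1 + p.2) / √2) = (· / √2) ∘ fun p : ℝ × ℝ => p.1 + p.2 := rfl
    rw [this, ← Measure.map_map (by fun_prop) (by fun_prop)]
    change ((gaussianReal 0 1) ∗ (gaussianReal 0 1)).map _ = _
    rw [gaussianReal_conv_gaussianReal, gaussianReal_map_div_const]
    congr 1
    · simp
    · ext; norm_num
  have h2 := measurePreserving_pi (fun _ : Fin s => (gaussianReal 0 1).prod (gaussianReal 0 1))
    (fun _ : Fin s => gaussianReal 0 1) (f := fun _ p => (p.1 + p.2) / √2) (fun _ => h1)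
  exact h2.comp (measurePreserving_arrowProdEquivProdArrow ℝ ℝ (Fin s)
    (fun _ => gaussianReal 0 1) (fun _ => gaussianReal 0 1)).symm

end Gaussian

/-- The density, with respect to the standard Gaussian measure, of the convolution of the standard
Gaussian measure with the image of `Q` under `x`. -/
def mixDens {α : Type*} [MeasurableSpace α] {s : ℕ} (Q : Measure α) (x : α → Fin s → ℝ)
    (z : Fin s → ℝ) : ℝ := ∫ m, gaussTilt (x m) z ∂Q

/-- The unnormalized posterior mean of `x` given the noisy observation `z`. -/
def mixMean {α : Type*} [MeasurableSpace α] {s : ℕ} (Q : Measure α) (x : α → Fin s → ℝ)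
    (z : Fin s → ℝ) (k : Fin s) : ℝ := ∫ m, gaussTilt (x m) z * x m k ∂Q

/-- The squared norm of the posterior mean times the density of the observation. -/
def fisherDens {α : Type*} [MeasurableSpace α] {s : ℕ} (Q : Measure α) (x : α → Fin s → ℝ)
    (z : Fin s → ℝ) : ℝ := (∑ k, mixMean Q x z k ^ 2) / mixDens Q x z

section Mixture

variable {α : Type*} [MeasurableSpace α] {s : ℕ} {Q : Measure α} {x : α → Fin s → ℝ}

lemma mixDens_nonneg (z : Fin s → ℝ) : 0 ≤ mixDens Q x z :=
  integral_nonneg fun _ => (gaussTilt_pos _ _).le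

lemma fisherDens_nonneg (z : Fin s → ℝ) : 0 ≤ fisherDens Q x z :=
  div_nonneg (Finset.sum_nonneg fun _ _ => sq_nonneg _) (mixDens_nonneg z)

variable [IsFiniteMeasure Q]

lemma measurable_mixDens (hx : Measurable x) : Measurable (mixDens Q x) :=
  (StronglyMeasurable.integral_prod_right' (ν := Q)
    (f := fun p : (Fin s → ℝ) × α => gaussTilt (x p.2) p.1)
    (Measurable.stronglyMeasurable (by fun_prop))).measurable

lemma measurable_mixMean (hx : Measurable x) (k : Fin s) :
    Measurable fun z => mixMean Q x z k :=
  (StronglyMeasurable.integral_prod_right' (ν := Q)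
    (f := fun p : (Fin s → ℝ) × α => gaussTilt (x p.2) p.1 * x p.2 k)
    (Measurable.stronglyMeasurable (by fun_prop))).measurable

lemma measurable_fisherDens (hx : Measurable x) : Measurable (fisherDens Q x) :=
  (Finset.measurable_sum _ fun k _ => (measurable_mixMean hx k).pow_const 2).div
    (measurable_mixDens hx)

lemma gaussTilt_le (x z : Fin s → ℝ) : gaussTilt x z ≤ Real.exp (∑ k, z k ^ 2 / 2) := by
  refine Real.exp_le_exp.2 (Finset.sum_le_sum fun k _ => ?_)
  nlinarith [sq_nonneg (x k - z k)]

lemma integrable_gaussTilt_left (hx : Measurable x) (z : Fin s → ℝ) :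
    Integrable (fun m => gaussTilt (x m) z) Q :=
  Integrable.of_bound (Measurable.aestronglyMeasurable (by fun_prop)) (Real.exp (∑ k, z k ^ 2 / 2))
    (Eventually.of_forall fun m => by
      rw [Real.norm_of_nonneg (gaussTilt_pos _ _).le]; exact gaussTilt_le _ _)

lemma mixDens_pos [NeZero Q] (hx : Measurable x) (z : Fin s → ℝ) : 0 < mixDens Q x z := by
  refine (integral_pos_iff_support_of_nonneg (fun _ => (gaussTilt_pos _ _).le)
    (integrable_gaussTilt_left hx z)).2 ?_
  have : Function.support (fun m => gaussTilt (x m) z) = Set.univ :=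
    Set.eq_univ_of_forall fun m => (gaussTilt_pos _ _).ne'
  rw [this]
  exact (Measure.measure_univ_pos).2 (NeZero.ne Q)

section Bounded

variable {R : ℝ}

lemma gaussTilt_le_exp_sum_abs {a z : Fin s → ℝ} (ha : ∀ k, |a k| ≤ R) :
    gaussTilt a z ≤ Real.exp (R * ∑ k, |z k|) := by
  rw [Finset.mul_sum]
  refine Real.exp_le_exp.2 (Finset.sum_le_sum fun k _ => ?_)
  have : a k * z k ≤ R * |z k| := by
    calc a k * z k ≤ |a k * z k| := le_abs_self _
      _ = |a k| * |z k| := abs_mul _ _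
      _ ≤ R * |z k| := by gcongr; exact ha k
  nlinarith [sq_nonneg (a k)]

lemma integrable_prod_stdGaussian_of_le {G : α × (Fin s → ℝ) → ℝ} (hG : Measurable G) (C c : ℝ)
    (h : ∀ m z, |G (m, z)| ≤ C * Real.exp (c * ∑ k, |z k|)) :
    Integrable G (Q.prod (_root_.stdGaussian s)) :=
  (((integrable_exp_mul_sum_abs_stdGaussian c).const_mul C).comp_snd Q).mono'
    hG.aestronglyMeasurable (Eventually.of_forall fun p => h p.1 p.2)

lemma integral_mul_eval_mixDens (hx : Measurable x) (hR : ∀ m k, |x m k| ≤ R)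
    (φ : (Fin s → ℝ) → ℝ) (hφ : Measurable φ) (C c : ℝ)
    (h : ∀ z, |φ z| ≤ C * Real.exp (c * ∑ k, |z k|)) :
    Integrable (fun z => mixDens Q x z * φ z) (_root_.stdGaussian s) ∧
    ∫ z, mixDens Q x z * φ z ∂_root_.stdGaussian s
      = ∫ m, ∫ z, gaussTilt (x m) z * φ z ∂_root_.stdGaussian s ∂Q := by
  have hint : Integrable (fun p : α × (Fin s → ℝ) => gaussTilt (x p.1) p.2 * φ p.2)
      (Q.prod (_root_.stdGaussian s)) := by
    refine integrable_prod_stdGaussian_of_le (by fun_prop) C (R + c) fun m z => ?_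
    rw [abs_mul, abs_of_pos (gaussTilt_pos _ _), add_mul, Real.exp_add, mul_left_comm]
    exact mul_le_mul (gaussTilt_le_exp_sum_abs (hR m)) (h z) (abs_nonneg _) (Real.exp_pos _).le
  simp_rw [mixDens, ← integral_mul_const]
  exact ⟨hint.integral_prod_right, (integral_integral_swap hint).symm⟩

lemma integrable_mixDens (hx : Measurable x) (hR : ∀ m k, |x m k| ≤ R) :
    Integrable (mixDens Q x) (_root_.stdGaussian s) := by
  simpa using (integral_mul_eval_mixDens (Q := Q) hx hR (fun _ => 1) measurable_const 1 0
    (by simp)).1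

lemma integral_mixDens (hx : Measurable x) (hR : ∀ m k, |x m k| ≤ R) :
    ∫ z, mixDens Q x z ∂_root_.stdGaussian s = Q.real Set.univ := by
  simpa [integral_gaussTilt] using (integral_mul_eval_mixDens (Q := Q) hx hR (fun _ => 1)
    measurable_const 1 0 (by simp)).2

lemma abs_eval_le_exp (z : Fin s → ℝ) (k : Fin s) : |z k| ≤ 1 * Real.exp (1 * ∑ k, |z k|) := by
  rw [one_mul, one_mul]
  calc |z k| ≤ ∑ k, |z k| := Finset.single_le_sum (fun i _ => abs_nonneg (z i)) (Finset.mem_univ k)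
    _ ≤ _ := by linarith [Real.add_one_le_exp (∑ k, |z k|)]

lemma integrable_mixDens_mul_eval (hx : Measurable x) (hR : ∀ m k, |x m k| ≤ R) (k : Fin s) :
    Integrable (fun z => mixDens Q x z * z k) (_root_.stdGaussian s) :=
  (integral_mul_eval_mixDens (Q := Q) hx hR (fun z => z k) (by fun_prop) 1 1
    fun z => abs_eval_le_exp z k).1

lemma integral_mixDens_mul_eval (hx : Measurable x) (hR : ∀ m k, |x m k| ≤ R) (k : Fin s) :
    ∫ z, mixDens Q x z * z k ∂_root_.stdGaussian s = ∫ m, x m k ∂Q := by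
  simpa [integral_gaussTilt_mul_eval] using (integral_mul_eval_mixDens (Q := Q) hx hR
    (fun z => z k) (by fun_prop) 1 1 fun z => abs_eval_le_exp z k).2

lemma integrable_mixMean (hx : Measurable x) (hR : ∀ m k, |x m k| ≤ R) (k : Fin s) :
    Integrable (fun z => mixMean Q x z k) (_root_.stdGaussian s) ∧
    ∫ z, mixMean Q x z k ∂_root_.stdGaussian s = ∫ m, x m k ∂Q := by
  have hint : Integrable (fun p : α × (Fin s → ℝ) => gaussTilt (x p.1) p.2 * x p.1 k)
      (Q.prod (_root_.stdGaussian s)) := by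
    refine integrable_prod_stdGaussian_of_le (by fun_prop) R R fun m z => ?_
    rw [abs_mul, abs_of_pos (gaussTilt_pos _ _), mul_comm R]
    exact mul_le_mul (gaussTilt_le_exp_sum_abs (hR m)) (hR m k) (abs_nonneg _) (Real.exp_pos _).le
  refine ⟨hint.integral_prod_right, ?_⟩
  unfold mixMean
  rw [← integral_integral_swap hint]
  simp [integral_mul_const, integral_gaussTilt]

lemma mixDens_le (hx : Measurable x) (hR : ∀ m k, |x m k| ≤ R) (z : Fin s → ℝ) :
    mixDens Q x z ≤ Q.real Set.univ * Real.exp (R * ∑ k, |z k|) := by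
  calc mixDens Q x z ≤ ∫ _, Real.exp (R * ∑ k, |z k|) ∂Q :=
        integral_mono (integrable_gaussTilt_left hx z) (integrable_const _) fun m =>
          gaussTilt_le_exp_sum_abs (hR m)
    _ = _ := by simp

lemma abs_mixMean_le (hx : Measurable x) (hR : ∀ m k, |x m k| ≤ R) (z : Fin s → ℝ) (k : Fin s) :
    |mixMean Q x z k| ≤ R * mixDens Q x z := by
  unfold mixMean mixDens
  rw [← integral_const_mul, ← Real.norm_eq_abs]
  refine norm_integral_le_of_norm_le ((integrable_gaussTilt_left (Q := Q) hx z).const_mul R)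
    (Eventually.of_forall fun m => ?_)
  rw [Real.norm_eq_abs, abs_mul, abs_of_pos (gaussTilt_pos _ _), mul_comm]
  exact mul_le_mul_of_nonneg_right (hR m k) (gaussTilt_pos _ _).le

lemma integrable_fisherDens_of_bounded (hx : Measurable x) (hR : ∀ m k, |x m k| ≤ R) :
    Integrable (fisherDens Q x) (_root_.stdGaussian s) := by
  refine ((integrable_mixDens (Q := Q) hx hR).const_mul (s * R ^ 2)).mono'
    (measurable_fisherDens hx).aestronglyMeasurable (Eventually.of_forall fun z => ?_)
  rw [Real.norm_of_nonneg (fisherDens_nonneg z)]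
  refine div_le_of_le_mul₀ (mixDens_nonneg z)
    (mul_nonneg (by positivity) (mixDens_nonneg z)) ?_
  calc ∑ k, mixMean Q x z k ^ 2 ≤ ∑ _k : Fin s, (R * mixDens Q x z) ^ 2 := by
        refine Finset.sum_le_sum fun k _ => ?_
        rw [← sq_abs]
        exact pow_le_pow_left₀ (abs_nonneg _) (abs_mixMean_le hx hR z k) 2
    _ = _ := by simp; ring

lemma abs_mul_log_le {t : ℝ} (ht : 0 ≤ t) : |t * Real.log t| ≤ 1 + t ^ 2 := by
  rcases ht.eq_or_lt with rfl | ht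
  · simp
  · rw [abs_le]
    have h1 := Real.one_sub_inv_le_log_of_pos ht
    have h2 := Real.log_le_sub_one_of_pos ht
    have h3 : t * (1 - t⁻¹) ≤ t * Real.log t := by gcongr
    have h4 : t * (1 - t⁻¹) = t - 1 := by field_simp
    constructor <;> nlinarith

lemma integrable_mixDens_mul_log (hx : Measurable x) (hR : ∀ m k, |x m k| ≤ R) :
    Integrable (fun z => mixDens Q x z * Real.log (mixDens Q x z)) (_root_.stdGaussian s) := by
  have hm := measurable_mixDens (Q := Q) hx
  refine ((integrable_const 1).add ((integrable_exp_mul_sum_abs_stdGaussian (2 * R)).const_mul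
    (Q.real Set.univ ^ 2))).mono' (by fun_prop) (Eventually.of_forall fun z => ?_)
  refine (abs_mul_log_le (mixDens_nonneg z)).trans ?_
  simp only [Pi.add_apply]
  gcongr
  calc mixDens Q x z ^ 2 ≤ (Q.real Set.univ * Real.exp (R * ∑ k, |z k|)) ^ 2 :=
        pow_le_pow_left₀ (mixDens_nonneg z) (mixDens_le hx hR z) 2
    _ = _ := by rw [mul_pow, ← Real.exp_nat_mul]; push_cast; ring_nf

end Bounded

end Mixture

section Bounded

variable {α : Type*} [MeasurableSpace α] {s : ℕ} {Q : Measure α} [IsFiniteMeasure Q]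
  {x : α → Fin s → ℝ} {R : ℝ}

lemma measureReal_univ_pos_of_neZero {α : Type*} [MeasurableSpace α] (Q : Measure α)
    [IsFiniteMeasure Q] [NeZero Q] : 0 < Q.real Set.univ :=
  ENNReal.toReal_pos (Measure.measure_univ_ne_zero.2 (NeZero.ne Q)) (measure_ne_top _ _)

lemma log_mul_gaussTilt {p : ℝ} (hp : 0 < p) (h z : Fin s → ℝ) :
    Real.log (p * gaussTilt h z) = Real.log p + ∑ k, (h k * z k - h k ^ 2 / 2) := by
  rw [Real.log_mul hp.ne' (gaussTilt_pos _ _).ne', gaussTilt, Real.log_exp]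

lemma integral_mixDens_mul_log_gaussTilt (hx : Measurable x) (hR : ∀ m k, |x m k| ≤ R) {p : ℝ}
    (hp : 0 < p) (h : Fin s → ℝ) :
    Integrable (fun z => mixDens Q x z * Real.log (p * gaussTilt h z)) (_root_.stdGaussian s) ∧
    ∫ z, mixDens Q x z * Real.log (p * gaussTilt h z) ∂_root_.stdGaussian s
      = Q.real Set.univ * Real.log p
        + ∑ k, (h k * ∫ m, x m k ∂Q - h k ^ 2 / 2 * Q.real Set.univ) := by
  have hu := integrable_mixDens (Q := Q) hx hR
  have hz := integrable_mixDens_mul_eval (Q := Q) hx hR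
  have heq : (fun z => mixDens Q x z * Real.log (p * gaussTilt h z))
      = fun z => Real.log p * mixDens Q x z
        + ∑ k, (h k * (mixDens Q x z * z k) - h k ^ 2 / 2 * mixDens Q x z) := by
    ext z
    rw [log_mul_gaussTilt hp, mul_add, Finset.mul_sum]
    congr 1
    · ring
    · exact Finset.sum_congr rfl fun k _ => by ring
  have hs : ∀ k ∈ Finset.univ, Integrable (fun z => h k * (mixDens Q x z * z k)
      - h k ^ 2 / 2 * mixDens Q x z) (_root_.stdGaussian s) :=
    fun k _ => ((hz k).const_mul _).sub (hu.const_mul _)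
  rw [heq]
  refine ⟨(hu.const_mul _).add (integrable_finsetSum _ hs), ?_⟩
  rw [integral_add (hu.const_mul _) (integrable_finsetSum _ hs), integral_finsetSum _ hs,
    integral_const_mul, integral_mixDens hx hR, mul_comm]
  congr 1
  refine Finset.sum_congr rfl fun k _ => ?_
  rw [integral_sub ((hz k).const_mul _) (hu.const_mul _), integral_const_mul, integral_const_mul,
    integral_mixDens hx hR, integral_mixDens_mul_eval hx hR]

lemma integral_gaussTilt_mul_div (a b h : Fin s → ℝ) :
    ∫ z, gaussTilt a z * gaussTilt b z / gaussTilt h z ∂_root_.stdGaussian s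
      = Real.exp (∑ k, (a k - h k) * (b k - h k)) := by
  have h1 : ∀ z, gaussTilt a z * gaussTilt b z / gaussTilt h z
      = Real.exp (∑ k, (h k ^ 2 / 2 - a k ^ 2 / 2 - b k ^ 2 / 2))
        * Real.exp (∑ k, (a k + b k - h k) * z k) := by
    intro z
    simp only [gaussTilt, ← Real.exp_add, ← Real.exp_sub, ← Finset.sum_add_distrib,
      ← Finset.sum_sub_distrib]
    congr 1
    exact Finset.sum_congr rfl fun k _ => by ring
  simp_rw [h1]
  rw [integral_const_mul, integral_exp_sum_mul_stdGaussian, ← Real.exp_add,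
    ← Finset.sum_add_distrib]
  congr 1
  exact Finset.sum_congr rfl fun k _ => by ring

lemma inv_gaussTilt_le {h z : Fin s → ℝ} (hh : ∀ k, |h k| ≤ R) :
    (gaussTilt h z)⁻¹ ≤ Real.exp (s * R ^ 2 / 2) * Real.exp (R * ∑ k, |z k|) := by
  rw [gaussTilt, ← Real.exp_neg, ← Real.exp_add, Finset.mul_sum]
  refine Real.exp_le_exp.2 ?_
  have : (s * R ^ 2 / 2 : ℝ) = ∑ _k : Fin s, R ^ 2 / 2 := by simp; ring
  rw [this, ← Finset.sum_add_distrib, ← Finset.sum_neg_distrib]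
  refine Finset.sum_le_sum fun k _ => ?_
  have h1 : -(h k * z k) ≤ R * |z k| := by
    calc -(h k * z k) ≤ |h k * z k| := neg_le_abs _
      _ = |h k| * |z k| := abs_mul _ _
      _ ≤ R * |z k| := by gcongr; exact hh k
  have h2 : h k ^ 2 ≤ R ^ 2 := by
    rw [← sq_abs]; exact pow_le_pow_left₀ (abs_nonneg _) (hh k) 2
  linarith

lemma integral_sq_mixDens_div (hx : Measurable x) (hR : ∀ m k, |x m k| ≤ R)
    {h : Fin s → ℝ} (hh : ∀ k, |h k| ≤ R) :
    Integrable (fun z => mixDens Q x z ^ 2 / gaussTilt h z) (_root_.stdGaussian s) ∧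
    ∫ z, mixDens Q x z ^ 2 / gaussTilt h z ∂_root_.stdGaussian s
      = ∫ p, Real.exp (∑ k, (x p.1 k - h k) * (x p.2 k - h k)) ∂(Q.prod Q) := by
  have hint : Integrable (fun p : (α × α) × (Fin s → ℝ) =>
      gaussTilt (x p.1.1) p.2 * gaussTilt (x p.1.2) p.2 / gaussTilt h p.2)
      ((Q.prod Q).prod (_root_.stdGaussian s)) := by
    refine integrable_prod_stdGaussian_of_le (by fun_prop) (Real.exp (s * R ^ 2 / 2)) (3 * R)
      fun m z => ?_
    rw [abs_of_nonneg (div_nonneg (mul_nonneg (gaussTilt_pos _ _).le (gaussTilt_pos _ _).le)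
      (gaussTilt_pos _ _).le), div_eq_mul_inv]
    calc _ ≤ Real.exp (R * ∑ k, |z k|) * Real.exp (R * ∑ k, |z k|)
          * (Real.exp (s * R ^ 2 / 2) * Real.exp (R * ∑ k, |z k|)) :=
          mul_le_mul (mul_le_mul (gaussTilt_le_exp_sum_abs (hR _)) (gaussTilt_le_exp_sum_abs (hR _))
            (gaussTilt_pos _ _).le (Real.exp_pos _).le) (inv_gaussTilt_le hh)
            (inv_nonneg.2 (gaussTilt_pos _ _).le) (by positivity)
      _ = _ := by simp only [← Real.exp_add]; ring_nf
  have heq : ∀ z, mixDens Q x z ^ 2 / gaussTilt h z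
      = ∫ p, gaussTilt (x p.1) z * gaussTilt (x p.2) z / gaussTilt h z ∂(Q.prod Q) := by
    intro z
    rw [integral_div, integral_prod_mul (fun m => gaussTilt (x m) z) (fun m => gaussTilt (x m) z),
      sq]
    rfl
  simp_rw [heq]
  refine ⟨hint.integral_prod_right, ?_⟩
  rw [← integral_integral_swap hint]
  simp_rw [integral_gaussTilt_mul_div]

lemma integral_exp_inner_le (hx : Measurable x) (hR : ∀ m k, |x m k| ≤ R)
    (hR' : 4 * s * R ^ 2 ≤ 1) {h : Fin s → ℝ} (hh : ∀ k, |h k| ≤ R)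
    (hmean : ∀ k, ∫ m, (x m k - h k) ∂Q = 0) :
    ∫ p, Real.exp (∑ k, (x p.1 k - h k) * (x p.2 k - h k)) ∂(Q.prod Q)
      ≤ (1 + 16 * s ^ 2 * R ^ 4) * Q.real Set.univ ^ 2 := by
  have hb : ∀ m k, |x m k - h k| ≤ 2 * R := fun m k =>
    (abs_sub _ _).trans (by linarith [hR m k, hh k])
  have hτ : ∀ p : α × α, |∑ k, (x p.1 k - h k) * (x p.2 k - h k)| ≤ 4 * s * R ^ 2 := by
    intro p
    calc _ ≤ ∑ k, |(x p.1 k - h k) * (x p.2 k - h k)| := Finset.abs_sum_le_sum_abs _ _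
      _ ≤ ∑ _k : Fin s, (2 * R) * (2 * R) := by
          refine Finset.sum_le_sum fun k _ => ?_
          rw [abs_mul]
          exact mul_le_mul (hb _ k) (hb _ k) (abs_nonneg _) ((abs_nonneg _).trans (hb p.1 k))
      _ = _ := by simp; ring
  have hiτ : Integrable (fun p : α × α => ∑ k, (x p.1 k - h k) * (x p.2 k - h k)) (Q.prod Q) :=
    Integrable.of_bound (Measurable.aestronglyMeasurable (by fun_prop)) _
      (Eventually.of_forall hτ)
  have hzero : ∫ p, ∑ k, (x p.1 k - h k) * (x p.2 k - h k) ∂(Q.prod Q) = 0 := by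
    rw [integral_finsetSum]
    · refine Finset.sum_eq_zero fun k _ => ?_
      rw [integral_prod_mul (fun m => x m k - h k) (fun m => x m k - h k), hmean, zero_mul]
    · intro k _
      refine Integrable.of_bound (Measurable.aestronglyMeasurable (by fun_prop)) ((2 * R) * (2 * R))
        (Eventually.of_forall fun p => ?_)
      rw [Real.norm_eq_abs, abs_mul]
      exact mul_le_mul (hb _ k) (hb _ k) (abs_nonneg _) ((abs_nonneg _).trans (hb p.1 k))
  calc _ ≤ ∫ p, ((1 + 16 * s ^ 2 * R ^ 4) + ∑ k, (x p.1 k - h k) * (x p.2 k - h k))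
          ∂(Q.prod Q) := by
        refine integral_mono (Integrable.of_bound (Measurable.aestronglyMeasurable (by fun_prop))
          (Real.exp (4 * s * R ^ 2)) (Eventually.of_forall fun p => ?_))
          ((integrable_const _).add hiτ) fun p => ?_
        · rw [Real.norm_of_nonneg (Real.exp_pos _).le]
          exact Real.exp_le_exp.2 ((le_abs_self _).trans (hτ p))
        · have h1 := Real.abs_exp_sub_one_sub_id_le ((hτ p).trans hR')
          have h2 : (∑ k, (x p.1 k - h k) * (x p.2 k - h k)) ^ 2 ≤ (4 * s * R ^ 2) ^ 2 := by
            rw [← sq_abs]; exact pow_le_pow_left₀ (abs_nonneg _) (hτ p) 2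
          have h3 := (le_abs_self _).trans h1
          dsimp only
          nlinarith
    _ = _ := by
        rw [integral_add (integrable_const _) hiτ, hzero, integral_const, add_zero, smul_eq_mul,
          mul_comm]
        congr 1
        rw [← Set.univ_prod_univ, measureReal_prod_prod, sq]

variable [NeZero Q]

lemma sum_sq_div_le_integral_fisherDens (hx : Measurable x) (hR : ∀ m k, |x m k| ≤ R) :
    (∑ k, (∫ m, x m k ∂Q) ^ 2) / Q.real Set.univ
      ≤ ∫ z, fisherDens Q x z ∂_root_.stdGaussian s := by
  have hp := measureReal_univ_pos_of_neZero Q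
  set p := Q.real Set.univ
  set h : Fin s → ℝ := fun k => (∫ m, x m k ∂Q) / p with hh
  have hu := integrable_mixDens (Q := Q) hx hR
  have hv := fun k => (integrable_mixMean (Q := Q) hx hR k).1
  have hs : ∀ k ∈ Finset.univ, Integrable (fun z => 2 * h k * mixMean Q x z k
      - h k ^ 2 * mixDens Q x z) (_root_.stdGaussian s) :=
    fun k _ => ((hv k).const_mul _).sub (hu.const_mul _)
  calc (∑ k, (∫ m, x m k ∂Q) ^ 2) / p
      = ∫ z, ∑ k, (2 * h k * mixMean Q x z k - h k ^ 2 * mixDens Q x z)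
          ∂_root_.stdGaussian s := by
        rw [integral_finsetSum _ hs, Finset.sum_div]
        refine Finset.sum_congr rfl fun k _ => ?_
        rw [integral_sub ((hv k).const_mul _) (hu.const_mul _), integral_const_mul,
          integral_const_mul, integral_mixDens hx hR, (integrable_mixMean hx hR k).2]
        change _ = 2 * h k * _ - h k ^ 2 * p
        simp only [hh]
        field_simp
        ring
    _ ≤ _ := by
        refine integral_mono (integrable_finsetSum _ hs) (integrable_fisherDens_of_bounded hx hR)
          fun z => ?_
        simp only [fisherDens, Finset.sum_div]
        refine Finset.sum_le_sum fun k _ => ?_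
        have hpos := mixDens_pos (Q := Q) hx z
        rw [le_div_iff₀ hpos]
        nlinarith [sq_nonneg (mixMean Q x z k - h k * mixDens Q x z)]

lemma half_sum_sq_div_le_of_bounded (hx : Measurable x) (hR : ∀ m k, |x m k| ≤ R) :
    Q.real Set.univ * Real.log (Q.real Set.univ)
        + 1 / 2 * ((∑ k, (∫ m, x m k ∂Q) ^ 2) / Q.real Set.univ)
      ≤ ∫ z, mixDens Q x z * Real.log (mixDens Q x z) ∂_root_.stdGaussian s := by
  have hp := measureReal_univ_pos_of_neZero Q
  set p := Q.real Set.univ with hp_def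
  set h : Fin s → ℝ := fun k => (∫ m, x m k ∂Q) / p with hh
  have hu := integrable_mixDens (Q := Q) hx hR
  obtain ⟨hl, hl'⟩ := integral_mixDens_mul_log_gaussTilt (Q := Q) hx hR hp h
  have hsub : Integrable (fun z => mixDens Q x z - p * gaussTilt h z) (_root_.stdGaussian s) :=
    hu.sub ((integrable_gaussTilt h).const_mul p)
  calc _ = ∫ z, (mixDens Q x z * Real.log (p * gaussTilt h z)
          + (mixDens Q x z - p * gaussTilt h z)) ∂_root_.stdGaussian s := by
        rw [integral_add hl hsub,
          integral_sub hu ((integrable_gaussTilt h).const_mul p), integral_const_mul,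
          integral_gaussTilt, integral_mixDens hx hR, hl', ← hp_def, mul_one, sub_self, add_zero,
          Finset.sum_div, Finset.mul_sum]
        congr 1
        refine Finset.sum_congr rfl fun k _ => ?_
        simp only [hh]
        field_simp
        ring
    _ ≤ _ := by
        refine integral_mono (hl.add hsub)
          (integrable_mixDens_mul_log hx hR) fun z => ?_
        have hpos := mixDens_pos (Q := Q) hx z
        have hc : 0 < p * gaussTilt h z := mul_pos hp (gaussTilt_pos _ _)
        have := Real.one_sub_inv_le_log_of_pos (div_pos hpos hc)
        rw [Real.log_div hpos.ne' hc.ne', inv_div] at this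
        have h2 := mul_le_mul_of_nonneg_left this hpos.le
        have h3 : mixDens Q x z * (1 - p * gaussTilt h z / mixDens Q x z)
            = mixDens Q x z - p * gaussTilt h z := by field_simp
        change mixDens Q x z * Real.log (p * gaussTilt h z)
          + (mixDens Q x z - p * gaussTilt h z) ≤ _
        linarith

lemma abs_integral_div_le (hR : ∀ m k, |x m k| ≤ R) (k : Fin s) :
    |(∫ m, x m k ∂Q) / Q.real Set.univ| ≤ R := by
  have hp := measureReal_univ_pos_of_neZero Q
  rw [abs_div, abs_of_pos hp, div_le_iff₀ hp, ← Real.norm_eq_abs]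
  exact norm_integral_le_of_norm_le_const (Eventually.of_forall fun m => hR m k)

lemma integral_mixDens_mul_log_le_of_small (hx : Measurable x) (hR : ∀ m k, |x m k| ≤ R)
    (hR' : 4 * s * R ^ 2 ≤ 1) :
    ∫ z, mixDens Q x z * Real.log (mixDens Q x z) ∂_root_.stdGaussian s
      ≤ Q.real Set.univ * Real.log (Q.real Set.univ)
        + 1 / 2 * ((∑ k, (∫ m, x m k ∂Q) ^ 2) / Q.real Set.univ)
        + 16 * s ^ 2 * R ^ 4 * Q.real Set.univ := by
  have hp := measureReal_univ_pos_of_neZero Q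
  set p := Q.real Set.univ with hp_def
  set h : Fin s → ℝ := fun k => (∫ m, x m k ∂Q) / p with hh
  have hhR : ∀ k, |h k| ≤ R := abs_integral_div_le hR
  have hmean : ∀ k, ∫ m, (x m k - h k) ∂Q = 0 := by
    intro k
    rw [integral_sub (Integrable.of_bound (Measurable.aestronglyMeasurable (by fun_prop)) R
      (Eventually.of_forall fun m => hR m k)) (integrable_const _), integral_const, smul_eq_mul,
      ← hp_def]
    simp only [hh]
    field_simp
    ring
  have hu := integrable_mixDens (Q := Q) hx hR
  obtain ⟨hl, hl'⟩ := integral_mixDens_mul_log_gaussTilt (Q := Q) hx hR hp h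
  obtain ⟨hq, hq'⟩ := integral_sq_mixDens_div (Q := Q) hx hR hhR
  have hsub : Integrable (fun z => p⁻¹ * (mixDens Q x z ^ 2 / gaussTilt h z) - mixDens Q x z)
      (_root_.stdGaussian s) := (hq.const_mul _).sub hu
  have hle := integral_exp_inner_le (Q := Q) hx hR hR' hhR hmean
  rw [← hq', ← hp_def] at hle
  calc _ ≤ ∫ z, (mixDens Q x z * Real.log (p * gaussTilt h z)
          + (p⁻¹ * (mixDens Q x z ^ 2 / gaussTilt h z) - mixDens Q x z)) ∂_root_.stdGaussian s := by
        refine integral_mono (integrable_mixDens_mul_log hx hR)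
          (hl.add hsub) fun z => ?_
        have hpos := mixDens_pos (Q := Q) hx z
        have hg := gaussTilt_pos h z
        have hc : 0 < p * gaussTilt h z := mul_pos hp hg
        have := Real.log_le_sub_one_of_pos (div_pos hpos hc)
        rw [Real.log_div hpos.ne' hc.ne'] at this
        have h2 := mul_le_mul_of_nonneg_left this hpos.le
        have h3 : mixDens Q x z * (mixDens Q x z / (p * gaussTilt h z) - 1)
            = p⁻¹ * (mixDens Q x z ^ 2 / gaussTilt h z) - mixDens Q x z := by field_simp
        dsimp only [Pi.add_apply, Pi.sub_apply]
        linarith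
    _ = p * Real.log p + 1 / 2 * ((∑ k, (∫ m, x m k ∂Q) ^ 2) / p)
        + (p⁻¹ * (∫ z, mixDens Q x z ^ 2 / gaussTilt h z ∂_root_.stdGaussian s) - p) := by
        rw [integral_add hl hsub, integral_sub (hq.const_mul _) hu,
          integral_const_mul, integral_mixDens hx hR, hl', ← hp_def, Finset.sum_div,
          Finset.mul_sum]
        congr 2
        refine Finset.sum_congr rfl fun k _ => ?_
        simp only [hh]
        field_simp
        ring
    _ ≤ _ := by
        have h1 := mul_le_mul_of_nonneg_left hle (inv_pos.2 hp).le
        have h2 : p⁻¹ * ((1 + 16 * s ^ 2 * R ^ 4) * p ^ 2) = p + 16 * s ^ 2 * R ^ 4 * p := by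
          field_simp
        linarith

end Bounded

section Dyadic

variable {α : Type*} [MeasurableSpace α] {s : ℕ} {Q : Measure α} {x : α → Fin s → ℝ} {R : ℝ}

/-- The unnormalized posterior given a noisy observation `y` of `x`. -/
def tiltMeasure (Q : Measure α) (x : α → Fin s → ℝ) (y : Fin s → ℝ) : Measure α :=
  Q.withDensity fun m => ENNReal.ofReal (gaussTilt (x m) y)

lemma integral_tiltMeasure (hx : Measurable x) (y : Fin s → ℝ) (f : α → ℝ) :
    ∫ m, f m ∂tiltMeasure Q x y = ∫ m, gaussTilt (x m) y * f m ∂Q := by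
  rw [tiltMeasure, integral_withDensity_eq_integral_toReal_smul (by fun_prop)
    (Eventually.of_forall fun _ => ENNReal.ofReal_lt_top)]
  simp_rw [ENNReal.toReal_ofReal (gaussTilt_pos _ _).le, smul_eq_mul]

lemma gaussTilt_div_sqrt_two_mul (a y y' : Fin s → ℝ) :
    gaussTilt (fun k => a k / √2) y * gaussTilt (fun k => a k / √2) y'
      = gaussTilt a fun k => (y k + y' k) / √2 := by
  simp only [gaussTilt, ← Real.exp_add, ← Finset.sum_add_distrib]
  congr 1
  refine Finset.sum_congr rfl fun k _ => ?_
  have : √(2 : ℝ) ^ 2 = 2 := Real.sq_sqrt (by norm_num)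
  rw [div_pow, this]
  ring

lemma mixDens_tiltMeasure (hx : Measurable x) (y y' : Fin s → ℝ) :
    mixDens (tiltMeasure Q (fun m k => x m k / √2) y) (fun m k => x m k / √2) y'
      = mixDens Q x fun k => (y k + y' k) / √2 := by
  rw [mixDens, integral_tiltMeasure (by fun_prop)]
  simp_rw [gaussTilt_div_sqrt_two_mul]
  rfl

lemma mixMean_tiltMeasure (hx : Measurable x) (y y' : Fin s → ℝ) (k : Fin s) :
    mixMean (tiltMeasure Q (fun m k => x m k / √2) y) (fun m k => x m k / √2) y' k
      = mixMean Q x (fun k => (y k + y' k) / √2) k / √2 := by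
  rw [mixMean, integral_tiltMeasure (by fun_prop)]
  simp_rw [← mul_assoc, gaussTilt_div_sqrt_two_mul, ← mul_div_assoc]
  rw [integral_div]
  rfl

lemma fisherDens_tiltMeasure (hx : Measurable x) (y y' : Fin s → ℝ) :
    fisherDens (tiltMeasure Q (fun m k => x m k / √2) y) (fun m k => x m k / √2) y'
      = fisherDens Q x (fun k => (y k + y' k) / √2) / 2 := by
  simp_rw [fisherDens, mixDens_tiltMeasure hx, mixMean_tiltMeasure hx, div_pow,
    Real.sq_sqrt zero_le_two, ← Finset.sum_div]
  ring

lemma integral_rotation_stdGaussian {F : (Fin s → ℝ) → ℝ}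
    (hF : Integrable F (_root_.stdGaussian s)) :
    Integrable (fun y => ∫ y', F (fun k => (y k + y' k) / √2) ∂_root_.stdGaussian s)
      (_root_.stdGaussian s) ∧
    ∫ y, ∫ y', F (fun k => (y k + y' k) / √2) ∂_root_.stdGaussian s ∂_root_.stdGaussian s
      = ∫ z, F z ∂_root_.stdGaussian s := by
  have h := measurePreserving_div_sqrt_two_stdGaussian (s := s)
  have hi := h.integrable_comp_of_integrable hF
  refine ⟨hi.integral_prod_left, ?_⟩
  have hm : ∫ z, F z ∂_root_.stdGaussian s = ∫ p : (Fin s → ℝ) × (Fin s → ℝ),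
      F (fun k => (p.1 k + p.2 k) / √2) ∂(_root_.stdGaussian s).prod (_root_.stdGaussian s) := by
    have hF' := hF.aestronglyMeasurable
    rw [← h.map_eq] at hF'
    rw [← integral_map h.measurable.aemeasurable hF', h.map_eq]
  rw [hm]
  exact (integral_prod _ hi).symm

lemma measureReal_tiltMeasure_univ (hx : Measurable x) (y : Fin s → ℝ) :
    (tiltMeasure Q x y).real Set.univ = mixDens Q x y := by
  have := integral_tiltMeasure (Q := Q) hx y fun _ => 1
  simpa [mixDens] using this

variable [IsFiniteMeasure Q]

lemma isFiniteMeasure_tiltMeasure (hx : Measurable x) (y : Fin s → ℝ) :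
    IsFiniteMeasure (tiltMeasure Q x y) :=
  isFiniteMeasure_withDensity_ofReal (integrable_gaussTilt_left hx y).2

lemma neZero_tiltMeasure [NeZero Q] (hx : Measurable x) (y : Fin s → ℝ) :
    NeZero (tiltMeasure Q x y) := by
  refine ⟨fun h => (mixDens_pos (Q := Q) hx y).ne' ?_⟩
  rw [← measureReal_tiltMeasure_univ hx, h]
  simp

end Dyadic

section LogSobolev

variable {α : Type*} [MeasurableSpace α] {s : ℕ}

lemma integral_mixDens_mul_log_le_add (j : ℕ) : ∀ (Q : Measure α) [IsFiniteMeasure Q] [NeZero Q]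
    (x : α → Fin s → ℝ) (R : ℝ), Measurable x → (∀ m k, |x m k| ≤ R) → 4 * s * R ^ 2 ≤ 2 ^ j →
    ∫ z, mixDens Q x z * Real.log (mixDens Q x z) ∂_root_.stdGaussian s
      ≤ Q.real Set.univ * Real.log (Q.real Set.univ)
        + 1 / 2 * ∫ z, fisherDens Q x z ∂_root_.stdGaussian s
        + 16 * s ^ 2 * R ^ 4 * Q.real Set.univ / 2 ^ j := by
  induction j with
  | zero =>
    intro Q _ _ x R hx hR hj
    have h1 := integral_mixDens_mul_log_le_of_small (Q := Q) hx hR (by simpa using hj)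
    have h2 := sum_sq_div_le_integral_fisherDens (Q := Q) hx hR
    simp only [pow_zero, div_one]
    linarith
  | succ j ih =>
    intro Q _ _ x R hx hR hj
    have h2 : √(2 : ℝ) ^ 2 = 2 := Real.sq_sqrt (by norm_num)
    have h4 : √(2 : ℝ) ^ 4 = 4 := by
      rw [show (4 : ℕ) = 2 * 2 from rfl, pow_mul, h2]; norm_num
    have hx' : Measurable fun m k => x m k / √2 := by fun_prop
    have hR' : ∀ m k, |x m k / √2| ≤ R / √2 := fun m k => by
      rw [abs_div, abs_of_pos (Real.sqrt_pos.2 two_pos : 0 < √(2 : ℝ))]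
      gcongr
      exact hR m k
    have hj' : 4 * s * (R / √2) ^ 2 ≤ 2 ^ j := by
      rw [div_pow, h2]; rw [pow_succ (2 : ℝ)] at hj; linarith
    have hF := integrable_mixDens_mul_log (Q := Q) hx hR
    have hJ := integrable_fisherDens_of_bounded (Q := Q) hx hR
    obtain ⟨hF1, hF2⟩ := integral_rotation_stdGaussian hF
    obtain ⟨hJ1, hJ2⟩ := integral_rotation_stdGaussian hJ
    have hfin := fun y => isFiniteMeasure_tiltMeasure (Q := Q) hx' y
    have hne := fun y => neZero_tiltMeasure (Q := Q) hx' y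
    have hu := integrable_mixDens (Q := Q) hx' hR'
    have hF' := integrable_mixDens_mul_log (Q := Q) hx' hR'
    have e0 := ih Q _ _ hx' hR' hj'
    have e1 := integral_mono hF1 ((hF'.add (hJ1.const_mul (1 / 4))).add
        (hu.const_mul (4 * s ^ 2 * R ^ 4 / 2 ^ j))) fun y => by
      have := ih (tiltMeasure Q (fun m k => x m k / √2) y) _ _ hx' hR' hj'
      simp_rw [mixDens_tiltMeasure hx, fisherDens_tiltMeasure hx,
        measureReal_tiltMeasure_univ hx', integral_div, div_pow, h4] at this
      simp only [Pi.add_apply]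
      refine this.trans (le_of_eq ?_)
      ring
    have e2 := integral_mono (integrable_fisherDens_of_bounded (Q := Q) hx' hR')
      (hJ1.const_mul (1 / 2)) fun y => by
        have := sum_sq_div_le_integral_fisherDens
          (Q := tiltMeasure Q (fun m k => x m k / √2) y) hx' hR'
        simp_rw [integral_tiltMeasure hx', fisherDens_tiltMeasure hx,
          measureReal_tiltMeasure_univ hx', integral_div] at this
        refine this.trans (le_of_eq ?_)
        ring
    rw [hF2, integral_add' (hF'.add (hJ1.const_mul (1 / 4))) (hu.const_mul _),
      integral_add' hF' (hJ1.const_mul _), integral_const_mul, integral_const_mul, hJ2,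
      integral_mixDens hx' hR'] at e1
    rw [integral_const_mul, hJ2] at e2
    rw [div_pow, h4] at e0
    have e3 : 16 * s ^ 2 * R ^ 4 * Q.real Set.univ / 2 ^ (j + 1)
        = 16 * s ^ 2 * (R ^ 4 / 4) * Q.real Set.univ / 2 ^ j
          + 4 * s ^ 2 * R ^ 4 / 2 ^ j * Q.real Set.univ := by
      rw [pow_succ]; field_simp; ring
    rw [e3]
    linarith

/-- The Gaussian logarithmic Sobolev inequality, for mixtures of translates with bounded
translations. -/
lemma integral_mixDens_mul_log_le_of_bounded {Q : Measure α} [IsFiniteMeasure Q] [NeZero Q]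
    {x : α → Fin s → ℝ} {R : ℝ} (hx : Measurable x) (hR : ∀ m k, |x m k| ≤ R) :
    ∫ z, mixDens Q x z * Real.log (mixDens Q x z) ∂_root_.stdGaussian s
      ≤ Q.real Set.univ * Real.log (Q.real Set.univ)
        + 1 / 2 * ∫ z, fisherDens Q x z ∂_root_.stdGaussian s := by
  have ht : Tendsto (fun j : ℕ => (2 : ℝ) ^ j) atTop atTop :=
    tendsto_pow_atTop_atTop_of_one_lt one_lt_two
  have hl : Tendsto (fun j : ℕ => Q.real Set.univ * Real.log (Q.real Set.univ)
        + 1 / 2 * ∫ z, fisherDens Q x z ∂_root_.stdGaussian s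
        + 16 * s ^ 2 * R ^ 4 * Q.real Set.univ / 2 ^ j) atTop
      (nhds (Q.real Set.univ * Real.log (Q.real Set.univ)
        + 1 / 2 * ∫ z, fisherDens Q x z ∂_root_.stdGaussian s + 0)) :=
    tendsto_const_nhds.add (tendsto_const_nhds.div_atTop ht)
  rw [add_zero] at hl
  refine ge_of_tendsto hl ?_
  filter_upwards [ht.eventually_ge_atTop (4 * s * R ^ 2)] with j hj
  exact integral_mixDens_mul_log_le_add j Q x R hx hR hj

end LogSobolev

section Truncation

variable {α : Type*} [MeasurableSpace α] {s : ℕ} {Q : Measure α} {x : α → Fin s → ℝ} {R : ℝ}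

lemma mixDens_congr {x' : α → Fin s → ℝ} (h : x =ᵐ[Q] x') : mixDens Q x = mixDens Q x' := by
  ext z
  exact integral_congr_ae (h.mono fun m hm => by simp only [hm])

lemma mixMean_congr {x' : α → Fin s → ℝ} (h : x =ᵐ[Q] x') : mixMean Q x = mixMean Q x' := by
  ext z k
  exact integral_congr_ae (h.mono fun m hm => by simp only [hm])

lemma fisherDens_congr {x' : α → Fin s → ℝ} (h : x =ᵐ[Q] x') :
    fisherDens Q x = fisherDens Q x' := by
  ext z
  rw [fisherDens, fisherDens, mixDens_congr h, mixMean_congr h]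

/-- The logarithmic Sobolev inequality and its converse, for a.e. bounded translations. -/
lemma integral_mixDens_mul_log_bounds_of_ae_bounded [IsFiniteMeasure Q] [NeZero Q]
    (hx : Measurable x) (hR0 : 0 ≤ R) (hR : ∀ᵐ m ∂Q, ∀ k, |x m k| ≤ R) :
    Q.real Set.univ * Real.log (Q.real Set.univ)
        + 1 / 2 * ((∑ k, (∫ m, x m k ∂Q) ^ 2) / Q.real Set.univ)
      ≤ ∫ z, mixDens Q x z * Real.log (mixDens Q x z) ∂_root_.stdGaussian s ∧
    ∫ z, mixDens Q x z * Real.log (mixDens Q x z) ∂_root_.stdGaussian s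
      ≤ Q.real Set.univ * Real.log (Q.real Set.univ)
        + 1 / 2 * ∫ z, fisherDens Q x z ∂_root_.stdGaussian s := by
  have hA : MeasurableSet {m | ∀ k, |x m k| ≤ R} :=
    MeasurableSet.congr (MeasurableSet.iInter fun k : Fin s =>
      measurableSet_le (f := fun m => |x m k|) (g := fun _ => R) (by fun_prop) measurable_const)
      (by ext; simp)
  set x' := Set.indicator {m | ∀ k, |x m k| ≤ R} x with hx'_def
  have hx' : Measurable x' := hx.indicator hA
  have hae : x =ᵐ[Q] x' := hR.mono fun m hm => by
    rw [hx'_def, Set.indicator_of_mem (s := {m | ∀ k, |x m k| ≤ R}) hm]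
  have hR' : ∀ m k, |x' m k| ≤ R := fun m k => by
    by_cases hm : m ∈ {m | ∀ k, |x m k| ≤ R}
    · rw [hx'_def, Set.indicator_of_mem hm]; exact hm k
    · rw [hx'_def, Set.indicator_of_notMem hm]; simpa using hR0
  have hk : ∀ k, ∫ m, x m k ∂Q = ∫ m, x' m k ∂Q := fun k =>
    integral_congr_ae (hae.mono fun m hm => by simp only [hm])
  rw [mixDens_congr hae, fisherDens_congr hae]
  simp_rw [hk]
  exact ⟨half_sum_sq_div_le_of_bounded hx' hR', integral_mixDens_mul_log_le_of_bounded hx' hR'⟩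

lemma integrable_gaussTilt_mul_left (hx : Measurable x) {f : α → ℝ} (hf : Integrable f Q)
    (z : Fin s → ℝ) : Integrable (fun m => gaussTilt (x m) z * f m) Q :=
  hf.bdd_mul (c := Real.exp (∑ k, z k ^ 2 / 2)) (Measurable.aestronglyMeasurable (by fun_prop))
    (Eventually.of_forall fun m => by
      rw [Real.norm_of_nonneg (gaussTilt_pos _ _).le]; exact gaussTilt_le _ _)

variable [IsFiniteMeasure Q]

lemma integrable_eval_of_sq (hx : Measurable x) (hx2 : Integrable (fun m => ∑ k, x m k ^ 2) Q)
    (k : Fin s) : Integrable (fun m => x m k) Q := by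
  refine ((integrable_const 1).add hx2).mono' (by fun_prop) (Eventually.of_forall fun m => ?_)
  have : x m k ^ 2 ≤ ∑ k, x m k ^ 2 :=
    Finset.single_le_sum (f := fun k => x m k ^ 2) (fun i _ => sq_nonneg _) (Finset.mem_univ k)
  rw [Real.norm_eq_abs, Pi.add_apply]
  nlinarith [sq_abs (x m k), sq_nonneg (|x m k| - 1)]

lemma fisherDens_le [NeZero Q] (hx : Measurable x)
    (hx2 : Integrable (fun m => ∑ k, x m k ^ 2) Q) (z : Fin s → ℝ) :
    fisherDens Q x z ≤ ∫ m, gaussTilt (x m) z * ∑ k, x m k ^ 2 ∂Q := by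
  have hu := mixDens_pos (Q := Q) hx z
  have hk : ∀ k, Integrable (fun m => x m k ^ 2) Q := fun k =>
    hx2.mono' (by fun_prop) (Eventually.of_forall fun m => by
      rw [Real.norm_of_nonneg (sq_nonneg _)]
      exact Finset.single_le_sum (f := fun k => x m k ^ 2) (fun i _ => sq_nonneg _)
        (Finset.mem_univ k))
  have h2 := fun k => integrable_gaussTilt_mul_left hx (hk k) z
  have h1 := fun k => integrable_gaussTilt_mul_left hx (integrable_eval_of_sq hx hx2 k) z
  have h0 := integrable_gaussTilt_left (Q := Q) hx z
  simp_rw [fisherDens, Finset.mul_sum]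
  rw [Finset.sum_div, integral_finsetSum _ fun k _ => h2 k]
  refine Finset.sum_le_sum fun k _ => ?_
  set c := mixMean Q x z k / mixDens Q x z with hc
  have hnn : 0 ≤ ∫ m, (gaussTilt (x m) z * x m k ^ 2 - 2 * c * (gaussTilt (x m) z * x m k)
      + c ^ 2 * gaussTilt (x m) z) ∂Q := by
    refine integral_nonneg fun m => ?_
    have := mul_nonneg (gaussTilt_pos (x m) z).le (sq_nonneg (x m k - c))
    simp only [Pi.zero_apply]
    nlinarith
  have hs : Integrable (fun m => gaussTilt (x m) z * x m k ^ 2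
      - 2 * c * (gaussTilt (x m) z * x m k)) Q := (h2 k).sub ((h1 k).const_mul _)
  rw [integral_add hs (h0.const_mul _), integral_sub (h2 k) ((h1 k).const_mul _),
    integral_const_mul, integral_const_mul] at hnn
  change 0 ≤ _ - 2 * c * mixMean Q x z k + c ^ 2 * mixDens Q x z at hnn
  have h3 : mixMean Q x z k ^ 2 / mixDens Q x z
      = 2 * c * mixMean Q x z k - c ^ 2 * mixDens Q x z := by
    rw [hc]; field_simp; ring
  linarith

lemma integrable_integral_gaussTilt_mul (hx : Measurable x) {f : α → ℝ} (hf : Integrable f Q)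
    (hfm : Measurable f) :
    Integrable (fun z => ∫ m, gaussTilt (x m) z * f m ∂Q) (_root_.stdGaussian s) := by
  have hm : Measurable fun p : α × (Fin s → ℝ) => gaussTilt (x p.1) p.2 * f p.1 :=
    (Measurable.gaussTilt (by fun_prop) (by fun_prop)).mul (by fun_prop)
  have : Integrable (fun p : α × (Fin s → ℝ) => gaussTilt (x p.1) p.2 * f p.1)
      (Q.prod (_root_.stdGaussian s)) := by
    refine (integrable_prod_iff hm.aestronglyMeasurable).2
      ⟨Eventually.of_forall fun m => (integrable_gaussTilt (x m)).mul_const (f m), ?_⟩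
    have h1 : ∀ m, ∫ z, ‖gaussTilt (x m) z * f m‖ ∂_root_.stdGaussian s = ‖f m‖ := fun m => by
      simp_rw [norm_mul, Real.norm_of_nonneg (gaussTilt_pos (x m) _).le]
      rw [integral_mul_const, integral_gaussTilt, one_mul]
    simp_rw [h1]
    exact hf.norm
  exact this.integral_prod_right

lemma abs_mul_log_le_of_le {t r : ℝ} (ht : 0 ≤ t) (htr : t ≤ r) :
    |t * Real.log t| ≤ 2 + |r * Real.log r| := by
  rcases le_total t 1 with h | h
  · have := abs_mul_log_le ht
    nlinarith [abs_nonneg (r * Real.log r)]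
  · have h1 : 0 ≤ Real.log t := Real.log_nonneg h
    have h2 : t * Real.log t ≤ r * Real.log r :=
      mul_le_mul htr (Real.log_le_log (by linarith) htr) h1 (by linarith)
    rw [abs_of_nonneg (mul_nonneg ht h1)]
    linarith [le_abs_self (r * Real.log r)]

/-- The logarithmic Sobolev inequality and its converse for Gaussian mixtures whose mixing measure
has finite second moment. -/
lemma integral_mixDens_mul_log_bounds [NeZero Q] (hx : Measurable x)
    (hx2 : Integrable (fun m => ∑ k, x m k ^ 2) Q)
    (hlog : Integrable (fun z => mixDens Q x z * Real.log (mixDens Q x z)) (_root_.stdGaussian s)) :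
    Q.real Set.univ * Real.log (Q.real Set.univ)
        + 1 / 2 * ((∑ k, (∫ m, x m k ∂Q) ^ 2) / Q.real Set.univ)
      ≤ ∫ z, mixDens Q x z * Real.log (mixDens Q x z) ∂_root_.stdGaussian s ∧
    ∫ z, mixDens Q x z * Real.log (mixDens Q x z) ∂_root_.stdGaussian s
      ≤ Q.real Set.univ * Real.log (Q.real Set.univ)
        + 1 / 2 * ∫ z, fisherDens Q x z ∂_root_.stdGaussian s := by
  set A : ℕ → Set α := fun N => {m | ∀ k, |x m k| ≤ N} with hA_def
  have hA : ∀ N, MeasurableSet (A N) := fun N =>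
    MeasurableSet.congr (MeasurableSet.iInter fun k : Fin s =>
      measurableSet_le (f := fun m => |x m k|) (g := fun _ => (N : ℝ)) (by fun_prop)
        measurable_const) (by ext; simp [hA_def])
  have hmono : Monotone A := fun N N' h m hm k => (hm k).trans (by exact_mod_cast h)
  have hU : ⋃ N, A N = Set.univ := by
    refine Set.eq_univ_of_forall fun m => Set.mem_iUnion.2 ?_
    obtain ⟨N, hN⟩ := exists_nat_ge (∑ k, |x m k|)
    exact ⟨N, fun k => (Finset.single_le_sum (f := fun k => |x m k|)
      (fun i _ => abs_nonneg _) (Finset.mem_univ k)).trans hN⟩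
  have hlim : ∀ {f : α → ℝ}, Integrable f Q →
      Tendsto (fun N => ∫ m, f m ∂Q.restrict (A N)) atTop (nhds (∫ m, f m ∂Q)) := by
    intro f hf
    have := tendsto_setIntegral_of_monotone hA hmono (f := f) (μ := Q) (by rw [hU]; simpa using hf)
    rwa [hU, setIntegral_univ] at this
  have hp := measureReal_univ_pos_of_neZero Q
  have hplim : Tendsto (fun N => (Q.restrict (A N)).real Set.univ) atTop
      (nhds (Q.real Set.univ)) := by
    simpa using hlim (integrable_const (1 : ℝ))
  have ha := fun k => hlim (integrable_eval_of_sq hx hx2 k)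
  have hu : ∀ z, Tendsto (fun N => mixDens (Q.restrict (A N)) x z) atTop (nhds (mixDens Q x z)) :=
    fun z => hlim (integrable_gaussTilt_left hx z)
  have hv : ∀ z k, Tendsto (fun N => mixMean (Q.restrict (A N)) x z k) atTop
      (nhds (mixMean Q x z k)) :=
    fun z k => hlim (integrable_gaussTilt_mul_left hx (integrable_eval_of_sq hx hx2 k) z)
  have hev : ∀ᶠ N in atTop, NeZero (Q.restrict (A N)) := by
    filter_upwards [hplim.eventually (lt_mem_nhds hp)] with N hN
    refine ⟨fun h => ?_⟩
    simp [h] at hN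
  have hule : ∀ N z, mixDens (Q.restrict (A N)) x z ≤ mixDens Q x z := fun N z =>
    setIntegral_le_integral (integrable_gaussTilt_left hx z)
      (Eventually.of_forall fun m => (gaussTilt_pos _ _).le)
  have hplog : Tendsto (fun N => (Q.restrict (A N)).real Set.univ
      * Real.log ((Q.restrict (A N)).real Set.univ)) atTop
      (nhds (Q.real Set.univ * Real.log (Q.real Set.univ))) :=
    (Real.continuous_mul_log.tendsto _).comp hplim
  have hulog : Tendsto (fun N => ∫ z, mixDens (Q.restrict (A N)) x z
      * Real.log (mixDens (Q.restrict (A N)) x z) ∂_root_.stdGaussian s) atTop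
      (nhds (∫ z, mixDens Q x z * Real.log (mixDens Q x z) ∂_root_.stdGaussian s)) := by
    refine tendsto_integral_of_dominated_convergence
      (fun z => 2 + |mixDens Q x z * Real.log (mixDens Q x z)|) (fun N => ?_)
      ((integrable_const _).add hlog.abs) (fun N => Eventually.of_forall fun z => ?_)
      (Eventually.of_forall fun z => (Real.continuous_mul_log.tendsto _).comp (hu z))
    · have := measurable_mixDens (Q := Q.restrict (A N)) hx
      exact Measurable.aestronglyMeasurable (by fun_prop)
    · exact abs_mul_log_le_of_le (mixDens_nonneg z) (hule N z)
  have hJ : Tendsto (fun N => ∫ z, fisherDens (Q.restrict (A N)) x z ∂_root_.stdGaussian s) atTop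
      (nhds (∫ z, fisherDens Q x z ∂_root_.stdGaussian s)) := by
    refine tendsto_integral_filter_of_dominated_convergence
      (fun z => ∫ m, gaussTilt (x m) z * ∑ k, x m k ^ 2 ∂Q)
      (Eventually.of_forall fun N => (measurable_fisherDens hx).aestronglyMeasurable)
      (hev.mono fun N hN => Eventually.of_forall fun z => ?_)
      (integrable_integral_gaussTilt_mul hx hx2 (by fun_prop))
      (Eventually.of_forall fun z => ?_)
    · rw [Real.norm_of_nonneg (fisherDens_nonneg z)]
      exact (fisherDens_le hx hx2.integrableOn z).trans
        (setIntegral_le_integral (integrable_gaussTilt_mul_left hx hx2 z)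
          (Eventually.of_forall fun m => mul_nonneg (gaussTilt_pos _ _).le
            (Finset.sum_nonneg fun _ _ => sq_nonneg _)))
    · exact (tendsto_finsetSum _ fun k _ => (hv z k).pow 2).div (hu z) (mixDens_pos hx z).ne'
  have hb : ∀ᶠ N in atTop, _ := hev.mono fun N hN =>
    integral_mixDens_mul_log_bounds_of_ae_bounded (Q := Q.restrict (A N)) hx (Nat.cast_nonneg N)
      (ae_restrict_mem (hA N))
  exact ⟨le_of_tendsto_of_tendsto (hplog.add (((tendsto_finsetSum _ fun k _ => (ha k).pow 2).div
      hplim hp.ne').const_mul _)) hulog (hb.mono fun N h => h.1),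
    le_of_tendsto_of_tendsto hulog (hplog.add (hJ.const_mul _)) (hb.mono fun N h => h.2)⟩

end Truncation

/-- `L` is a positive density of the law of `(M, T)` with respect to the product of the law of `M`
and the reference measure `ν`, with integrable logarithm. -/
structure IsChannelDensity {Ω α β : Type*} [MeasurableSpace Ω] [MeasurableSpace α]
    [MeasurableSpace β] (μ : Measure Ω) (M : Ω → α) (T : Ω → β) (ν : Measure β)
    (L : α × β → ℝ) : Prop where
  measurable : Measurable L
  pos : ∀ p, 0 < L p
  map_eq : μ.map (fun ω => (M ω, T ω))
    = ((μ.map M).prod ν).withDensity fun p => ENNReal.ofReal (L p)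
  integrable_log : Integrable (fun ω => Real.log (L (M ω, T ω))) μ

/-- The marginal in the second variable of a density on a product space. -/
def margDens {α β : Type*} [MeasurableSpace α] (P : Measure α) (L : α × β → ℝ) (b : β) : ℝ :=
  ∫ m, L (m, b) ∂P

lemma measurable_margDens {α β : Type*} [MeasurableSpace α] [MeasurableSpace β] {P : Measure α}
    [SFinite P] {L : α × β → ℝ} (hL : Measurable L) : Measurable (margDens P L) :=
  (StronglyMeasurable.integral_prod_left' (μ := P) hL.stronglyMeasurable).measurable

lemma margDens_nonneg {α β : Type*} [MeasurableSpace α] {P : Measure α} {L : α × β → ℝ}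
    (hL : ∀ p, 0 ≤ L p) (b : β) : 0 ≤ margDens P L b :=
  integral_nonneg fun m => hL (m, b)

/-- The mutual information between `M` and `T` when `L` is a channel density. -/
def channelInfo {Ω α β : Type*} [MeasurableSpace Ω] [MeasurableSpace α] (μ : Measure Ω)
    (M : Ω → α) (T : Ω → β) (L : α × β → ℝ) : ℝ :=
  ∫ ω, Real.log (L (M ω, T ω)) ∂μ - ∫ ω, Real.log (margDens (μ.map M) L (T ω)) ∂μ

namespace IsChannelDensity

variable {Ω α β : Type*} [MeasurableSpace Ω] [MeasurableSpace α] [MeasurableSpace β]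
  {μ : Measure Ω} {M : Ω → α} {T : Ω → β} {ν : Measure β} {L : α × β → ℝ}

section Basic

variable (H : IsChannelDensity μ M T ν L) (hM : Measurable M) (hT : Measurable T)
include H hM hT

lemma integrable_comp_iff {h : α × β → ℝ} (hh : Measurable h) :
    Integrable (fun ω => h (M ω, T ω)) μ ↔
      Integrable (fun p => L p * h p) ((μ.map M).prod ν) := by
  have h1 := integrable_map_measure (μ := μ) (f := fun ω => (M ω, T ω)) (g := h)
    hh.aestronglyMeasurable (hM.prodMk hT).aemeasurable
  have hL := H.measurable
  rw [show (fun ω => h (M ω, T ω)) = h ∘ fun ω => (M ω, T ω) from rfl, ← h1, H.map_eq,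
    integrable_withDensity_iff_integrable_smul' (by fun_prop)
    (Eventually.of_forall fun _ => ENNReal.ofReal_lt_top)]
  simp_rw [ENNReal.toReal_ofReal (H.pos _).le, smul_eq_mul]

lemma integral_comp {h : α × β → ℝ} (hh : Measurable h) :
    ∫ ω, h (M ω, T ω) ∂μ = ∫ p, L p * h p ∂((μ.map M).prod ν) := by
  have hL := H.measurable
  rw [← integral_map (φ := fun ω => (M ω, T ω)) (hM.prodMk hT).aemeasurable
    hh.aestronglyMeasurable, H.map_eq, integral_withDensity_eq_integral_toReal_smul (by fun_prop)
    (Eventually.of_forall fun _ => ENNReal.ofReal_lt_top)]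
  simp_rw [ENNReal.toReal_ofReal (H.pos _).le, smul_eq_mul]

lemma integrable [IsFiniteMeasure μ] : Integrable L ((μ.map M).prod ν) := by
  simpa using (H.integrable_comp_iff hM hT (h := fun _ => 1) measurable_const).1
    (integrable_const 1)

lemma integrable_mul_log : Integrable (fun p => L p * Real.log (L p)) ((μ.map M).prod ν) :=
  (H.integrable_comp_iff hM hT H.measurable.log).1 H.integrable_log

end Basic

variable [IsProbabilityMeasure μ] [IsProbabilityMeasure ν]

section Marginal

variable (H : IsChannelDensity μ M T ν L) (hM : Measurable M) (hT : Measurable T)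
include H hM hT

lemma ae_integrable : ∀ᵐ b ∂ν, Integrable (fun m => L (m, b)) (μ.map M) :=
  (H.integrable hM hT).prod_left_ae

lemma ae_margDens_pos : ∀ᵐ b ∂ν, 0 < margDens (μ.map M) L b := by
  have := Measure.isProbabilityMeasure_map (μ := μ) hM.aemeasurable
  filter_upwards [H.ae_integrable hM hT] with b hb
  refine (integral_pos_iff_support_of_nonneg (fun m => (H.pos (m, b)).le) hb).2 ?_
  rw [show Function.support (fun m => L (m, b)) = Set.univ from
    Set.eq_univ_of_forall fun m => (H.pos (m, b)).ne', measure_univ]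
  exact one_pos

lemma map_snd_eq : μ.map T = ν.withDensity fun b => ENNReal.ofReal (margDens (μ.map M) L b) := by
  have hL := H.measurable
  ext B hB
  have h1 : μ.map T B = μ.map (fun ω => (M ω, T ω)) (Prod.snd ⁻¹' B) := by
    rw [Measure.map_apply hT hB, Measure.map_apply (hM.prodMk hT) (measurable_snd hB)]
    rfl
  rw [h1, H.map_eq, withDensity_apply _ (measurable_snd hB), withDensity_apply _ hB,
    show (Prod.snd ⁻¹' B : Set (α × β)) = Set.univ ×ˢ B by ext; simp,
    setLIntegral_prod_symm _ (by fun_prop)]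
  refine setLIntegral_congr_fun_ae hB ?_
  filter_upwards [H.ae_integrable hM hT] with b hb _
  rw [setLIntegral_univ, margDens, ofReal_integral_eq_lintegral_ofReal hb
    (Eventually.of_forall fun m => (H.pos _).le)]

lemma integrable_comp_snd_iff {h : β → ℝ} (hh : Measurable h) :
    Integrable (fun ω => h (T ω)) μ ↔ Integrable (fun b => margDens (μ.map M) L b * h b) ν := by
  have h1 := integrable_map_measure (μ := μ) (f := T) (g := h) hh.aestronglyMeasurable
    hT.aemeasurable
  have hg := measurable_margDens (P := μ.map M) H.measurable
  rw [show (fun ω => h (T ω)) = h ∘ T from rfl, ← h1, H.map_snd_eq hM hT,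
    integrable_withDensity_iff_integrable_smul' (by fun_prop)
    (Eventually.of_forall fun _ => ENNReal.ofReal_lt_top)]
  simp_rw [ENNReal.toReal_ofReal (margDens_nonneg (fun p => (H.pos p).le) _), smul_eq_mul]

lemma integral_comp_snd {h : β → ℝ} (hh : Measurable h) :
    ∫ ω, h (T ω) ∂μ = ∫ b, margDens (μ.map M) L b * h b ∂ν := by
  have hg := measurable_margDens (P := μ.map M) H.measurable
  rw [← integral_map hT.aemeasurable hh.aestronglyMeasurable, H.map_snd_eq hM hT,
    integral_withDensity_eq_integral_toReal_smul (by fun_prop)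
    (Eventually.of_forall fun _ => ENNReal.ofReal_lt_top)]
  simp_rw [ENNReal.toReal_ofReal (margDens_nonneg (fun p => (H.pos p).le) _), smul_eq_mul]

lemma integrable_margDens_mul_log :
    Integrable (fun b => margDens (μ.map M) L b * Real.log (margDens (μ.map M) L b)) ν := by
  have := Measure.isProbabilityMeasure_map (μ := μ) hM.aemeasurable
  have hg := measurable_margDens (P := μ.map M) H.measurable
  have hi := H.integrable_mul_log hM hT
  refine ((integrable_const 1).add hi.integral_prod_right.norm).mono' (by fun_prop) ?_
  filter_upwards [H.ae_integrable hM hT, H.ae_margDens_pos hM hT, hi.prod_left_ae] with b h1 h2 h3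
  have hJ := Real.convexOn_mul_log.map_integral_le Real.continuous_mul_log.continuousOn
    isClosed_Ici (Eventually.of_forall fun m => (H.pos (m, b)).le) h1 h3
  change margDens (μ.map M) L b * Real.log (margDens (μ.map M) L b) ≤ _ at hJ
  have hlow := mul_le_mul_of_nonneg_left (Real.one_sub_inv_le_log_of_pos h2) h2.le
  rw [mul_sub, mul_inv_cancel₀ h2.ne'] at hlow
  simp only [Pi.add_apply, Real.norm_eq_abs]
  rw [abs_le]
  constructor
  · linarith [abs_nonneg (∫ m, L (m, b) * Real.log (L (m, b)) ∂μ.map M)]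
  · linarith [le_abs_self (∫ m, L (m, b) * Real.log (L (m, b)) ∂μ.map M)]

lemma integrable_log_margDens :
    Integrable (fun ω => Real.log (margDens (μ.map M) L (T ω))) μ :=
  (H.integrable_comp_snd_iff hM hT (measurable_margDens H.measurable).log).2
    (H.integrable_margDens_mul_log hM hT)

lemma mutualInfo_eq : mutualInfo μ M T = ((channelInfo μ M T L : ℝ) : EReal) := by
  have := Measure.isProbabilityMeasure_map (μ := μ) hM.aemeasurable
  have := Measure.isProbabilityMeasure_map (μ := μ) hT.aemeasurable
  have hL := H.measurable
  have hg := measurable_margDens (P := μ.map M) H.measurable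
  set g := margDens (μ.map M) L with hg_def
  set ρ := (μ.map M).prod (μ.map T) with hρ_def
  have hρ : ρ = ((μ.map M).prod ν).withDensity fun p => ENNReal.ofReal (g p.2) := by
    rw [hρ_def, H.map_snd_eq hM hT, prod_withDensity_right hg.ennreal_ofReal]
  have hpos : ∀ᵐ p ∂(μ.map M).prod ν, 0 < g p.2 :=
    Measure.quasiMeasurePreserving_snd.ae (H.ae_margDens_pos hM hT)
  have hπ : μ.map (fun ω => (M ω, T ω)) = ρ.withDensity fun p => ENNReal.ofReal (L p / g p.2) := by
    rw [hρ, ← withDensity_mul _ (by fun_prop) (by fun_prop), H.map_eq]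
    refine withDensity_congr_ae (hpos.mono fun p hp => ?_)
    rw [Pi.mul_apply, ← ENNReal.ofReal_mul hp.le, mul_div_cancel₀ _ hp.ne']
  have hac : μ.map (fun ω => (M ω, T ω)) ≪ ρ := hπ ▸ withDensity_absolutelyContinuous _ _
  have hρac : ρ ≪ (μ.map M).prod ν := hρ ▸ withDensity_absolutelyContinuous _ _
  have hrn : (μ.map fun ω => (M ω, T ω)).rnDeriv ρ =ᵐ[ρ] fun p => ENNReal.ofReal (L p / g p.2) := by
    rw [hπ]
    exact Measure.rnDeriv_withDensity ρ (by fun_prop)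
  have hllr : llr (μ.map fun ω => (M ω, T ω)) ρ =ᵐ[μ.map fun ω => (M ω, T ω)]
      fun p => Real.log (L p) - Real.log (g p.2) := by
    filter_upwards [hac.ae_le hrn, hac.ae_le (hρac.ae_le hpos)] with p hp hp'
    rw [llr, hp, ENNReal.toReal_ofReal (div_nonneg (H.pos p).le hp'.le),
      Real.log_div (H.pos p).ne' hp'.ne']
  have hm : Measurable fun p : α × β => Real.log (L p) - Real.log (g p.2) := by fun_prop
  have hint : Integrable (fun ω => Real.log (L (M ω, T ω)) - Real.log (g (T ω))) μ :=
    H.integrable_log.sub (H.integrable_log_margDens hM hT)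
  have hint' : Integrable (llr (μ.map fun ω => (M ω, T ω)) ρ) (μ.map fun ω => (M ω, T ω)) :=
    (integrable_congr hllr).2 ((integrable_map_measure hm.aestronglyMeasurable
      (hM.prodMk hT).aemeasurable).2 hint)
  rw [mutualInfo, if_pos ⟨hac, hint'⟩, integral_congr_ae hllr,
    integral_map (hM.prodMk hT).aemeasurable hm.aestronglyMeasurable,
    integral_sub H.integrable_log (H.integrable_log_margDens hM hT), channelInfo]

end Marginal

end IsChannelDensity

lemma integrable_eval_sq_of_sqNorm {Ω : Type*} [MeasurableSpace Ω] {μ : Measure Ω} {s : ℕ}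
    {F : Ω → Fin s → ℝ} (hF : Measurable F) (h : Integrable (fun ω => sqNorm (F ω)) μ)
    (k : Fin s) : Integrable (fun ω => F ω k ^ 2) μ :=
  h.mono' (by fun_prop) (Eventually.of_forall fun ω => by
    rw [Real.norm_of_nonneg (sq_nonneg _)]
    exact Finset.single_le_sum (f := fun k => F ω k ^ 2) (fun i _ => sq_nonneg _)
      (Finset.mem_univ k))

lemma integral_sub_condExp_sq {Ω : Type*} {m m₀ : MeasurableSpace Ω} {μ : Measure Ω}
    [IsFiniteMeasure μ] (hm : m ≤ m₀) {X : Ω → ℝ} (hX : MemLp X 2 μ) :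
    ∫ ω, (X ω - (μ[X | m]) ω) ^ 2 ∂μ = ∫ ω, X ω ^ 2 ∂μ - ∫ ω, (μ[X | m]) ω ^ 2 ∂μ := by
  have h1 : ∫ ω, (X ω - (μ[X | m]) ω) ^ 2 ∂μ = ∫ ω, (Var[X; μ | m]) ω ∂μ := by
    rw [condVar, integral_condExp hm]
    rfl
  have h2 : Integrable (μ[X | m] ^ 2) μ := (hX.condExp one_le_two).integrable_sq
  rw [h1, integral_congr_ae (condVar_ae_eq_condExp_sq_sub_sq_condExp hm hX),
    integral_sub' integrable_condExp h2, integral_condExp hm]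
  rfl

namespace IsChannelDensity

variable {Ω α β : Type*} [MeasurableSpace Ω] [MeasurableSpace α] [MeasurableSpace β]
  {μ : Measure Ω} {M : Ω → α} {T : Ω → β} {ν : Measure β} {L : α × β → ℝ}
  [IsProbabilityMeasure μ] [IsProbabilityMeasure ν]
  (H : IsChannelDensity μ M T ν L) (hM : Measurable M) (hT : Measurable T)
include H hM hT

/-- Bayes' formula. -/
lemma condExp_ae_eq {f : α × β → ℝ} (hf : Measurable f)
    (hint : Integrable (fun ω => f (M ω, T ω)) μ) :
    μ[fun ω => f (M ω, T ω) | MeasurableSpace.comap T inferInstance] =ᵐ[μ]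
      fun ω => margDens (μ.map M) (fun p => L p * f p) (T ω) / margDens (μ.map M) L (T ω) := by
  have := Measure.isProbabilityMeasure_map (μ := μ) hM.aemeasurable
  have hL := H.measurable
  have hg := measurable_margDens (P := μ.map M) hL
  have ha := measurable_margDens (P := μ.map M) (hL.mul hf)
  have hLf := (H.integrable_comp_iff hM hT hf).1 hint
  have hquot : ∀ᵐ b ∂ν, margDens (μ.map M) L b * (margDens (μ.map M) (fun p => L p * f p) b
      / margDens (μ.map M) L b) = margDens (μ.map M) (fun p => L p * f p) b :=
    (H.ae_margDens_pos hM hT).mono fun b hb => mul_div_cancel₀ _ hb.ne'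
  have hi : Integrable (fun ω => margDens (μ.map M) (fun p => L p * f p) (T ω)
      / margDens (μ.map M) L (T ω)) μ :=
    (H.integrable_comp_snd_iff hM hT (ha.div hg)).2
      ((integrable_congr hquot).2 hLf.integral_prod_right)
  refine (ae_eq_condExp_of_forall_setIntegral_eq hT.comap_le hint
    (fun _ _ _ => hi.integrableOn) ?_ ?_).symm
  · rintro _ ⟨B, hB, rfl⟩ -
    have h1 := H.integral_comp_snd hM hT ((ha.div hg).indicator hB)
    have h2 := H.integral_comp hM hT (hf.indicator (measurable_snd hB))
    have e1 : ∫ ω in T ⁻¹' B, margDens (μ.map M) (fun p => L p * f p) (T ω)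
        / margDens (μ.map M) L (T ω) ∂μ = ∫ ω, B.indicator (fun b =>
          margDens (μ.map M) (fun p => L p * f p) b / margDens (μ.map M) L b) (T ω) ∂μ := by
      rw [← integral_indicator (hT hB)]
      rfl
    have e2 : ∫ ω in T ⁻¹' B, f (M ω, T ω) ∂μ
        = ∫ ω, (Prod.snd ⁻¹' B).indicator f (M ω, T ω) ∂μ := by
      rw [← integral_indicator (hT hB)]
      rfl
    have e3 : ∀ p : α × β, L p * (Prod.snd ⁻¹' B).indicator f p
        = (Prod.snd ⁻¹' B).indicator (fun p => L p * f p) p := fun p =>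
      (Set.indicator_mul_right (Prod.snd ⁻¹' B) L f).symm
    rw [e1, e2]
    refine h1.trans (Eq.trans ?_ h2.symm)
    simp_rw [e3]
    rw [integral_prod_symm _ (hLf.indicator (measurable_snd hB))]
    refine integral_congr_ae (hquot.mono fun b hb => ?_)
    by_cases hbB : b ∈ B
    · have hm : ∀ m, (m, b) ∈ (Prod.snd ⁻¹' B : Set (α × β)) := fun m => hbB
      simp only [Set.indicator_of_mem hbB, Set.indicator_of_mem (hm _)]
      exact hb
    · have hm : ∀ m, (m, b) ∉ (Prod.snd ⁻¹' B : Set (α × β)) := fun m => hbB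
      simp [Set.indicator_of_notMem hbB, Set.indicator_of_notMem (hm _)]
  · exact ((ha.div hg).comp (comap_measurable T)).aestronglyMeasurable

lemma integral_sub_condExp_sq_eq {f : α × β → ℝ} (hf : Measurable f)
    (hint : Integrable (fun ω => f (M ω, T ω) ^ 2) μ) :
    Integrable (fun b => margDens (μ.map M) (fun p => L p * f p) b ^ 2
      / margDens (μ.map M) L b) ν ∧
    ∫ ω, (f (M ω, T ω) - (μ[fun ω => f (M ω, T ω) | MeasurableSpace.comap T inferInstance]) ω) ^ 2
        ∂μ = ∫ ω, f (M ω, T ω) ^ 2 ∂μ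
      - ∫ b, margDens (μ.map M) (fun p => L p * f p) b ^ 2 / margDens (μ.map M) L b ∂ν := by
  have := Measure.isProbabilityMeasure_map (μ := μ) hM.aemeasurable
  have hL := H.measurable
  have hg := measurable_margDens (P := μ.map M) hL
  have ha := measurable_margDens (P := μ.map M) (hL.mul hf)
  have hLp : MemLp (fun ω => f (M ω, T ω)) 2 μ :=
    (memLp_two_iff_integrable_sq (hf.comp (hM.prodMk hT)).aestronglyMeasurable).2 hint
  have hc := H.condExp_ae_eq hM hT hf (hLp.integrable one_le_two)
  have hsq : Integrable (fun ω => (μ[fun ω => f (M ω, T ω)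
      | MeasurableSpace.comap T inferInstance]) ω ^ 2) μ := (hLp.condExp one_le_two).integrable_sq
  have hc2 := hc.mono fun ω h => congrArg (· ^ 2) h
  have hm : Measurable fun b => (margDens (μ.map M) (fun p => L p * f p) b
      / margDens (μ.map M) L b) ^ 2 := (ha.div hg).pow_const 2
  have hquot : ∀ᵐ b ∂ν, margDens (μ.map M) L b * (margDens (μ.map M) (fun p => L p * f p) b
      / margDens (μ.map M) L b) ^ 2
      = margDens (μ.map M) (fun p => L p * f p) b ^ 2 / margDens (μ.map M) L b :=
    (H.ae_margDens_pos hM hT).mono fun b hb => by field_simp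
  refine ⟨(integrable_congr hquot).1 ((H.integrable_comp_snd_iff hM hT hm).1
    ((integrable_congr hc2).1 hsq)), ?_⟩
  rw [integral_sub_condExp_sq hT.comap_le hLp, ← integral_congr_ae hquot,
    ← H.integral_comp_snd hM hT hm, integral_congr_ae hc2]

lemma integral_sqNorm_sub_condExp {s : ℕ} {f : α × β → Fin s → ℝ} (hf : Measurable f)
    (hint : Integrable (fun ω => sqNorm (f (M ω, T ω))) μ) :
    Integrable (fun b => (∑ k, margDens (μ.map M) (fun p => L p * f p k) b ^ 2)
      / margDens (μ.map M) L b) ν ∧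
    ∫ ω, sqNorm (f (M ω, T ω)
        - (μ[fun ω => f (M ω, T ω) | MeasurableSpace.comap T inferInstance]) ω) ∂μ
      = ∫ ω, sqNorm (f (M ω, T ω)) ∂μ
      - ∫ b, (∑ k, margDens (μ.map M) (fun p => L p * f p k) b ^ 2)
          / margDens (μ.map M) L b ∂ν := by
  have hF : Measurable fun ω => f (M ω, T ω) := hf.comp (hM.prodMk hT)
  have hfk : ∀ k, Measurable fun p => f p k := fun k => by fun_prop
  have hk := integrable_eval_sq_of_sqNorm hF hint
  have hLp : ∀ k, MemLp (fun ω => f (M ω, T ω) k) 2 μ := fun k =>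
    (memLp_two_iff_integrable_sq
      ((hfk k).comp (hM.prodMk hT)).aestronglyMeasurable).2 (hk k)
  have hFi : Integrable (fun ω => f (M ω, T ω)) μ :=
    Integrable.of_eval fun k => (hLp k).integrable one_le_two
  have h := fun k => H.integral_sub_condExp_sq_eq hM hT (hfk k) (hk k)
  have hproj : ∀ k, (fun ω => (μ[fun ω => f (M ω, T ω)
      | MeasurableSpace.comap T inferInstance]) ω k) =ᵐ[μ]
      μ[fun ω => f (M ω, T ω) k | MeasurableSpace.comap T inferInstance] := fun k =>
    ContinuousLinearMap.comp_condExp_comm hFi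
      (ContinuousLinearMap.proj (R := ℝ) (φ := fun _ : Fin s => ℝ) k)
  have hcong : (fun ω => sqNorm (f (M ω, T ω)
        - (μ[fun ω => f (M ω, T ω) | MeasurableSpace.comap T inferInstance]) ω)) =ᵐ[μ]
      fun ω => ∑ k, (f (M ω, T ω) k
        - (μ[fun ω => f (M ω, T ω) k | MeasurableSpace.comap T inferInstance]) ω) ^ 2 := by
    filter_upwards [eventually_all.2 hproj] with ω hω
    exact Finset.sum_congr rfl fun k _ => by rw [← hω k, Pi.sub_apply]
  have hd : ∀ k ∈ Finset.univ, Integrable (fun ω => (f (M ω, T ω) k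
      - (μ[fun ω => f (M ω, T ω) k | MeasurableSpace.comap T inferInstance]) ω) ^ 2) μ :=
    fun k _ => ((hLp k).sub ((hLp k).condExp one_le_two)).integrable_sq
  simp_rw [Finset.sum_div]
  refine ⟨integrable_finsetSum _ fun k _ => (h k).1, ?_⟩
  rw [integral_congr_ae hcong, integral_finsetSum _ hd,
    integral_finsetSum _ fun k _ => (h k).1]
  simp only [sqNorm]
  rw [integral_finsetSum _ fun k _ => hk k, ← Finset.sum_sub_distrib]
  exact Finset.sum_congr rfl fun k _ => (h k).2

end IsChannelDensity

/-- The channel density after an additional use of a Gaussian channel with input `f`. -/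
def gaussChannelDens {α β : Type*} {s : ℕ} (L : α × β → ℝ) (f : α × β → Fin s → ℝ)
    (p : α × (β × (Fin s → ℝ))) : ℝ :=
  L (p.1, p.2.1) * gaussTilt (f (p.1, p.2.1)) p.2.2

namespace IsChannelDensity

variable {Ω α β : Type*} [MeasurableSpace Ω] [MeasurableSpace α] [MeasurableSpace β]
  {μ : Measure Ω} {M : Ω → α} {T : Ω → β} {ν : Measure β} {L : α × β → ℝ}
  [IsProbabilityMeasure μ] [IsProbabilityMeasure ν] {s : ℕ} {f : α × β → Fin s → ℝ}
  {W : Ω → Fin s → ℝ}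
  (H : IsChannelDensity μ M T ν L) (hM : Measurable M) (hT : Measurable T) (hf : Measurable f)
  (hint : Integrable (fun ω => sqNorm (f (M ω, T ω))) μ)
  (hW : Measurable W) (hlaw : μ.map W = _root_.stdGaussian s)
  (hind : IndepFun W (fun ω => (M ω, T ω)) μ)
include H hM hT hf hW hlaw hind

lemma map_gaussChannel :
    μ.map (fun ω => (M ω, (T ω, f (M ω, T ω) + W ω)))
      = ((μ.map M).prod (ν.prod (_root_.stdGaussian s))).withDensity
        fun p => ENNReal.ofReal (gaussChannelDens L f p) := by
  have hL := H.measurable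
  have hMT := hM.prodMk hT
  have hjoint : μ.map (fun ω => ((M ω, T ω), W ω))
      = (μ.map fun ω => (M ω, T ω)).prod (_root_.stdGaussian s) := by
    rw [← hlaw]
    exact (indepFun_iff_map_prod_eq_prod_map_map hMT.aemeasurable hW.aemeasurable).1 hind.symm
  refine Measure.ext_of_lintegral _ fun h hh => ?_
  have hL' : Measurable (gaussChannelDens L f) :=
    (hL.comp (by fun_prop)).mul (Measurable.gaussTilt (by fun_prop) (by fun_prop))
  have hshift : ∀ p : α × β, ∫⁻ w, h (p.1, p.2, f p + w) ∂_root_.stdGaussian s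
      = ∫⁻ z, ENNReal.ofReal (gaussTilt (f p) z) * h (p.1, p.2, z) ∂_root_.stdGaussian s := by
    intro p
    rw [← lintegral_map (f := fun z => h (p.1, p.2, z)) (g := fun w => f p + w) (by fun_prop)
      (by fun_prop), stdGaussian_map_add, lintegral_withDensity_eq_lintegral_mul _
      (Measurable.ennreal_ofReal (by fun_prop)) (by fun_prop)]
    rfl
  rw [lintegral_map hh (by fun_prop),
    ← lintegral_map (μ := μ) (f := fun q : (α × β) × (Fin s → ℝ) => h (q.1.1, q.1.2, f q.1 + q.2))
      (g := fun ω => ((M ω, T ω), W ω)) (by fun_prop) (by fun_prop), hjoint,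
    lintegral_prod _ (by fun_prop), H.map_eq]
  simp_rw [hshift]
  have hin : Measurable fun q : (α × β) × (Fin s → ℝ) =>
      ENNReal.ofReal (gaussTilt (f q.1) q.2) * h (q.1.1, q.1.2, q.2) :=
    (Measurable.gaussTilt (by fun_prop) (by fun_prop)).ennreal_ofReal.mul (by fun_prop)
  rw [lintegral_withDensity_eq_lintegral_mul _ (by fun_prop) hin.lintegral_prod_right',
    lintegral_withDensity_eq_lintegral_mul _ hL'.ennreal_ofReal hh,
    lintegral_prod _ (hL.ennreal_ofReal.mul hin.lintegral_prod_right').aemeasurable,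
    lintegral_prod _ (hL'.ennreal_ofReal.mul hh).aemeasurable]
  refine lintegral_congr fun m => ?_
  have hm : Measurable fun y : β × (Fin s → ℝ) =>
      ((fun p => ENNReal.ofReal (gaussChannelDens L f p)) * h) (m, y) :=
    (hL'.ennreal_ofReal.mul hh).comp measurable_prodMk_left
  rw [lintegral_prod _ hm.aemeasurable]
  refine lintegral_congr fun b => ?_
  have hmb : Measurable fun z : Fin s → ℝ =>
      ENNReal.ofReal (gaussTilt (f (m, b)) z) * h (m, b, z) :=
    (Measurable.gaussTilt (by fun_prop) (by fun_prop)).ennreal_ofReal.mul (by fun_prop)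
  simp only [Pi.mul_apply]
  rw [← lintegral_const_mul _ hmb]
  refine lintegral_congr fun z => ?_
  simp only [gaussChannelDens]
  rw [ENNReal.ofReal_mul (H.pos _).le, mul_assoc]

include hint

omit [IsProbabilityMeasure ν] in
lemma integrable_log_gaussChannelDens :
    Integrable (fun ω => Real.log (gaussChannelDens L f (M ω, (T ω, f (M ω, T ω) + W ω)))) μ ∧
    ∫ ω, Real.log (gaussChannelDens L f (M ω, (T ω, f (M ω, T ω) + W ω))) ∂μ
      = ∫ ω, Real.log (L (M ω, T ω)) ∂μ + 1 / 2 * ∫ ω, sqNorm (f (M ω, T ω)) ∂μ := by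
  have hF : Measurable fun ω => f (M ω, T ω) := hf.comp (hM.prodMk hT)
  have hk := integrable_eval_sq_of_sqNorm hF hint
  have hFk : ∀ k, Integrable (fun ω => f (M ω, T ω) k) μ := fun k =>
    ((memLp_two_iff_integrable_sq ((measurable_pi_apply k).comp hF).aestronglyMeasurable).2
      (hk k)).integrable one_le_two
  have hWi : ∀ k, Integrable (fun ω => W ω k) μ ∧ ∫ ω, W ω k ∂μ = 0 := fun k => by
    have h1 := integrable_eval_stdGaussian (s := s) k
    have h2 := integral_eval_stdGaussian (s := s) k
    rw [← hlaw] at h1 h2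
    exact ⟨(integrable_map_measure (measurable_pi_apply k).aestronglyMeasurable
        hW.aemeasurable).1 h1,
      (integral_map hW.aemeasurable
        (measurable_pi_apply k).aestronglyMeasurable).symm.trans h2⟩
  have hindk : ∀ k, IndepFun (fun ω => f (M ω, T ω) k) (fun ω => W ω k) μ := fun k =>
    hind.symm.comp (φ := fun p => f p k) (ψ := fun w : Fin s → ℝ => w k) (by fun_prop)
      (by fun_prop)
  have hprod : ∀ k, Integrable (fun ω => f (M ω, T ω) k * W ω k) μ := fun k =>
    (hindk k).integrable_mul (hFk k) (hWi k).1
  have hzero : ∀ k, ∫ ω, f (M ω, T ω) k * W ω k ∂μ = 0 := fun k => by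
    rw [(hindk k).integral_fun_mul_eq_mul_integral (hFk k).aestronglyMeasurable
      (hWi k).1.aestronglyMeasurable, (hWi k).2, mul_zero]
  have heq : (fun ω => Real.log (gaussChannelDens L f (M ω, (T ω, f (M ω, T ω) + W ω))))
      = fun ω => (Real.log (L (M ω, T ω)) + 1 / 2 * sqNorm (f (M ω, T ω)))
        + ∑ k, f (M ω, T ω) k * W ω k := by
    ext ω
    rw [gaussChannelDens, Real.log_mul (H.pos _).ne' (gaussTilt_pos _ _).ne', gaussTilt,
      Real.log_exp, sqNorm, Finset.mul_sum, add_assoc, ← Finset.sum_add_distrib]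
    congr 1
    exact Finset.sum_congr rfl fun k _ => by simp only [Pi.add_apply]; ring
  have h1 : Integrable (fun ω => Real.log (L (M ω, T ω)) + 1 / 2 * sqNorm (f (M ω, T ω))) μ :=
    H.integrable_log.add (hint.const_mul _)
  rw [heq]
  refine ⟨h1.add (integrable_finsetSum _ fun k _ => hprod k), ?_⟩
  rw [integral_add h1 (integrable_finsetSum _ fun k _ => hprod k),
    integral_add H.integrable_log (hint.const_mul _), integral_const_mul,
    integral_finsetSum _ fun k _ => hprod k]
  simp [hzero]

lemma gaussChannel : IsChannelDensity μ M (fun ω => (T ω, f (M ω, T ω) + W ω))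
    (ν.prod (_root_.stdGaussian s)) (gaussChannelDens L f) where
  measurable := (H.measurable.comp (by fun_prop)).mul
    (Measurable.gaussTilt (by fun_prop) (by fun_prop))
  pos _ := mul_pos (H.pos _) (gaussTilt_pos _ _)
  map_eq := H.map_gaussChannel hM hT hf hW hlaw hind
  integrable_log := (H.integrable_log_gaussChannelDens hM hT hf hint hW hlaw hind).1

/-- One more use of a Gaussian channel increases the information by at least half the causal and at
most half the predicted mean square error. -/
lemma channelInfo_gaussChannel :
    channelInfo μ M T L + 1 / 2 * ∫ ω, sqNorm (f (M ω, T ω) - (μ[fun ω => f (M ω, T ω) |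
        MeasurableSpace.comap (fun ω => (T ω, f (M ω, T ω) + W ω)) inferInstance]) ω) ∂μ
      ≤ channelInfo μ M (fun ω => (T ω, f (M ω, T ω) + W ω)) (gaussChannelDens L f) ∧
    channelInfo μ M (fun ω => (T ω, f (M ω, T ω) + W ω)) (gaussChannelDens L f)
      ≤ channelInfo μ M T L + 1 / 2 * ∫ ω, sqNorm (f (M ω, T ω) - (μ[fun ω => f (M ω, T ω) |
        MeasurableSpace.comap T inferInstance]) ω) ∂μ := by
  have := Measure.isProbabilityMeasure_map (μ := μ) hM.aemeasurable
  have hL := H.measurable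
  have hT' : Measurable fun ω => (T ω, f (M ω, T ω) + W ω) := by fun_prop
  have H' := H.gaussChannel hM hT hf hint hW hlaw hind
  set P := μ.map M with hP
  set Q : β → Measure α := fun b => P.withDensity fun m => ENNReal.ofReal (L (m, b)) with hQ
  have hQint : ∀ b (h : α → ℝ), ∫ m, h m ∂Q b = ∫ m, L (m, b) * h m ∂P := by
    intro b h
    rw [hQ, integral_withDensity_eq_integral_toReal_smul (by fun_prop)
      (Eventually.of_forall fun _ => ENNReal.ofReal_lt_top)]
    simp_rw [ENNReal.toReal_ofReal (H.pos _).le, smul_eq_mul]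
  have hmass : ∀ b, (Q b).real Set.univ = margDens P L b := fun b => by
    simpa [margDens] using hQint b fun _ => 1
  have hmean : ∀ b k, ∫ m, f (m, b) k ∂Q b = margDens P (fun p => L p * f p k) b :=
    fun b k => hQint b _
  have hdens : ∀ b z, mixDens (Q b) (fun m => f (m, b)) z
      = margDens P (gaussChannelDens L f) (b, z) := fun b z => hQint b _
  have hmixMean : ∀ b z k, mixMean (Q b) (fun m => f (m, b)) z k
      = margDens P (fun p => gaussChannelDens L f p * f (p.1, p.2.1) k) (b, z) := fun b z k => by
    rw [mixMean, hQint, margDens]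
    simp only [gaussChannelDens, mul_assoc]
  have hfisher : ∀ b z, fisherDens (Q b) (fun m => f (m, b)) z
      = (∑ k, margDens P (fun p => gaussChannelDens L f p * f (p.1, p.2.1) k) (b, z) ^ 2)
        / margDens P (gaussChannelDens L f) (b, z) := fun b z => by
    simp_rw [fisherDens, hdens, hmixMean]
  have hsq := (H.integrable_comp_iff hM hT (h := fun p => sqNorm (f p))
    (by unfold sqNorm; fun_prop)).1 hint
  have hlog' := H'.integrable_margDens_mul_log hM hT'
  have hlog := H.integrable_margDens_mul_log hM hT
  obtain ⟨hp1, hp2⟩ := H.integral_sqNorm_sub_condExp hM hT hf hint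
  obtain ⟨hc1, hc2⟩ := H'.integral_sqNorm_sub_condExp hM hT'
    (f := fun p => f (p.1, p.2.1)) (by fun_prop) hint
  simp only [← hP] at hp1 hp2 hc1 hc2 hlog hlog'
  have hb : ∀ᵐ b ∂ν,
      (Q b).real Set.univ * Real.log ((Q b).real Set.univ)
          + 1 / 2 * ((∑ k, (∫ m, f (m, b) k ∂Q b) ^ 2) / (Q b).real Set.univ)
        ≤ ∫ z, mixDens (Q b) (fun m => f (m, b)) z *
            Real.log (mixDens (Q b) (fun m => f (m, b)) z) ∂_root_.stdGaussian s ∧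
      ∫ z, mixDens (Q b) (fun m => f (m, b)) z *
            Real.log (mixDens (Q b) (fun m => f (m, b)) z) ∂_root_.stdGaussian s
        ≤ (Q b).real Set.univ * Real.log ((Q b).real Set.univ)
          + 1 / 2 * ∫ z, fisherDens (Q b) (fun m => f (m, b)) z ∂_root_.stdGaussian s := by
    filter_upwards [H.ae_integrable hM hT, H.ae_margDens_pos hM hT, hsq.prod_left_ae,
      hlog'.prod_right_ae] with b h1 h2 h3 h4
    have : IsFiniteMeasure (Q b) := isFiniteMeasure_withDensity_ofReal h1.2
    have : NeZero (Q b) := ⟨fun h => h2.ne' (by rw [← hP, ← hmass, h]; simp)⟩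
    have h5 : Integrable (fun m => ∑ k, f (m, b) k ^ 2) (Q b) := by
      rw [hQ, integrable_withDensity_iff_integrable_smul' (by fun_prop)
        (Eventually.of_forall fun _ => ENNReal.ofReal_lt_top)]
      simp_rw [ENNReal.toReal_ofReal (H.pos _).le, smul_eq_mul]
      exact h3
    exact integral_mixDens_mul_log_bounds (Q := Q b) (x := fun m => f (m, b)) (by fun_prop) h5
      (by simp_rw [hdens]; exact h4)
  simp only [hmass, hmean, hdens, hfisher] at hb
  have i1 := integral_mono_ae (hlog.add (hp1.const_mul (1 / 2))) hlog'.integral_prod_left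
    (hb.mono fun b h => h.1)
  have i2 := integral_mono_ae hlog'.integral_prod_left
    (hlog.add (hc1.integral_prod_left.const_mul (1 / 2))) (hb.mono fun b h => h.2)
  rw [integral_add' hlog (hp1.const_mul _), integral_const_mul, ← integral_prod _ hlog'] at i1
  rw [integral_add' hlog (hc1.integral_prod_left.const_mul _), integral_const_mul,
    ← integral_prod _ hlog', ← integral_prod _ hc1] at i2
  have e1 := H.integral_comp_snd hM hT (measurable_margDens (P := P) hL).log
  have e2 := H'.integral_comp_snd hM hT' (measurable_margDens (P := P) H'.measurable).log
  have e3 := (H.integrable_log_gaussChannelDens hM hT hf hint hW hlaw hind).2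
  simp only [channelInfo, ← hP] at *
  rw [e1, e2, e3, hp2, hc2]
  constructor <;> linarith

end IsChannelDensity

namespace IsChannelDensity

variable {Ω α β γ : Type*} [MeasurableSpace Ω] [MeasurableSpace α] [MeasurableSpace β]
  [MeasurableSpace γ] {μ : Measure Ω} {M : Ω → α} {T : Ω → β} {ν : Measure β} {L : α × β → ℝ}

lemma measurableEquiv_comp [IsProbabilityMeasure μ] [IsProbabilityMeasure ν]
    (H : IsChannelDensity μ M T ν L) (hM : Measurable M) (hT : Measurable T) (e : β ≃ᵐ γ) :
    IsChannelDensity μ M (fun ω => e (T ω)) (ν.map e) (fun p => L (p.1, e.symm p.2)) where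
  measurable := H.measurable.comp (by fun_prop)
  pos _ := H.pos _
  map_eq := by
    have := Measure.isProbabilityMeasure_map (μ := μ) hM.aemeasurable
    have := Measure.isProbabilityMeasure_map (μ := ν) e.measurable.aemeasurable
    have hL := H.measurable
    have hprod : (μ.map M).prod (ν.map e) = ((μ.map M).prod ν).map (Prod.map id e) := by
      rw [← Measure.map_prod_map _ _ measurable_id e.measurable, Measure.map_id]
    have hL' : Measurable fun p : α × γ => ENNReal.ofReal (L (p.1, e.symm p.2)) := by fun_prop
    refine Measure.ext_of_lintegral _ fun h hh => ?_
    have hhe : Measurable fun p : α × β => h (p.1, e p.2) := by fun_prop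
    rw [lintegral_map hh (by fun_prop),
      ← lintegral_map (μ := μ) (f := fun p : α × β => h (p.1, e p.2)) (g := fun ω => (M ω, T ω))
        hhe (by fun_prop), H.map_eq,
      lintegral_withDensity_eq_lintegral_mul _ (by fun_prop) hhe,
      lintegral_withDensity_eq_lintegral_mul _ hL' hh, hprod,
      lintegral_map (hL'.mul hh) (by fun_prop)]
    simp [Prod.map_def]
  integrable_log := by simpa using H.integrable_log

end IsChannelDensity

lemma channelInfo_measurableEquiv_comp {Ω α β γ : Type*} [MeasurableSpace Ω] [MeasurableSpace α]
    [MeasurableSpace β] [MeasurableSpace γ] (μ : Measure Ω) (M : Ω → α) (T : Ω → β)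
    (L : α × β → ℝ) (e : β ≃ᵐ γ) :
    channelInfo μ M (fun ω => e (T ω)) (fun p => L (p.1, e.symm p.2)) = channelInfo μ M T L := by
  simp [channelInfo, margDens]

/-- Appending a coordinate to a tuple, as a measurable equivalence. -/
def snocMeasurableEquiv (E : Type*) [MeasurableSpace E] (k : ℕ) :
    (Fin k → E) × E ≃ᵐ (Fin (k + 1) → E) :=
  MeasurableEquiv.prodComm.trans (MeasurableEquiv.piFinSuccAbove (fun _ => E) (Fin.last k)).symm

lemma snocMeasurableEquiv_eq {E : Type*} [MeasurableSpace E] {k : ℕ} (x : Fin (k + 1) → E) :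
    snocMeasurableEquiv E k (fun j => x j.castSucc, x (Fin.last k)) = x := by
  rw [← MeasurableEquiv.eq_symm_apply]
  ext <;> simp [snocMeasurableEquiv, MeasurableEquiv.piFinSuccAbove, MeasurableEquiv.prodComm,
    Fin.init]

lemma comap_history_eq_pastSigmaF {Ω β : Type*} [MeasurableSpace Ω] [MeasurableSpace β] {n : ℕ}
    (Y : Fin n → Ω → β) {k : ℕ} (hk : k ≤ n) :
    MeasurableSpace.comap (fun ω (j : Fin k) => Y (Fin.castLE hk j) ω) inferInstance
      = pastSigmaF Y k := by
  have h : MeasurableSpace.comap (fun ω (j : Fin k) => Y (Fin.castLE hk j) ω) inferInstance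
      = ⨆ j : Fin k, MeasurableSpace.comap (Y (Fin.castLE hk j)) inferInstance := by
    change MeasurableSpace.comap _ (MeasurableSpace.pi) = _
    simp only [MeasurableSpace.pi, MeasurableSpace.comap_iSup, MeasurableSpace.comap_comp]
    rfl
  rw [h, pastSigmaF]
  refine le_antisymm (iSup_le fun j => ?_) (iSup_le fun j => ?_)
  · exact le_iSup (fun j : {j : Fin n // (j : ℕ) < k} =>
      MeasurableSpace.comap (Y j) inferInstance) ⟨Fin.castLE hk j, j.isLt⟩
  · exact le_iSup (fun j : Fin k => MeasurableSpace.comap (Y (Fin.castLE hk j)) inferInstance)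
      ⟨j.1, j.2⟩

section Feedback

variable {Ω α : Type*} [MeasurableSpace Ω] [MeasurableSpace α] {μ : Measure Ω} {s n : ℕ}
  {M : Ω → α} {W : Fin (n + 1) → Ω → (Fin s → ℝ)}
  {φ : (i : Fin (n + 1)) → α × (Fin (i : ℕ) → (Fin s → ℝ)) → (Fin s → ℝ)}
  {Y Φ : Fin (n + 1) → Ω → (Fin s → ℝ)}
  (hφ : ∀ i, Measurable (φ i))
  (hΦ : ∀ i ω, Φ i ω = φ i (M ω, fun j : Fin (i : ℕ) => Y (Fin.castLE i.isLt.le j) ω))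
  (hY : ∀ i ω, Y i ω = Φ i ω + W i ω)
include hφ hΦ hY

omit [MeasurableSpace Ω] in
/-- The channel outputs are a measurable function of the message and the noise so far. -/
lemma exists_measurable_history (k : ℕ) (hk : k ≤ n + 1) :
    ∃ g : α × (Fin k → (Fin s → ℝ)) → (Fin k → (Fin s → ℝ)), Measurable g ∧
      ∀ ω, (fun j : Fin k => Y (Fin.castLE hk j) ω)
        = g (M ω, fun j : Fin k => W (Fin.castLE hk j) ω) := by
  induction k with
  | zero => exact ⟨fun p => p.2, measurable_snd, fun ω => Subsingleton.elim _ _⟩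
  | succ k ih =>
    obtain ⟨g, hg, hgY⟩ := ih (Nat.le_of_succ_le hk)
    have hφk : Measurable (φ ⟨k, hk⟩) := hφ ⟨k, hk⟩
    have hgk : Measurable fun p : α × (Fin (k + 1) → (Fin s → ℝ)) =>
        g (p.1, fun j => p.2 j.castSucc) := hg.comp (by fun_prop)
    refine ⟨fun p => snocMeasurableEquiv _ k (g (p.1, fun j => p.2 j.castSucc),
      φ ⟨k, hk⟩ (p.1, g (p.1, fun j => p.2 j.castSucc)) + p.2 (Fin.last k)),
      (MeasurableEquiv.measurable _).comp (hgk.prodMk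
        ((hφk.comp (measurable_fst.prodMk hgk)).add (by fun_prop))), fun ω => ?_⟩
    have h1 := hgY ω
    have h2 := hY ⟨k, hk⟩ ω
    rw [hΦ] at h2
    rw [← snocMeasurableEquiv_eq fun j : Fin (k + 1) => Y (Fin.castLE hk j) ω]
    congr 1
    refine Prod.ext h1 ?_
    refine h2.trans ?_
    congr 1
    exact congrArg (fun y => φ ⟨k, hk⟩ (M ω, y)) h1

variable (hM : Measurable M) (hWmeas : ∀ i, Measurable (W i))
include hM hWmeas

lemma measurable_history (k : ℕ) (hk : k ≤ n + 1) :
    Measurable fun ω (j : Fin k) => Y (Fin.castLE hk j) ω := by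
  obtain ⟨g, hg, hgY⟩ := exists_measurable_history hφ hΦ hY k hk
  rw [show (fun ω (j : Fin k) => Y (Fin.castLE hk j) ω) = fun ω => g _ from funext hgY]
  fun_prop

variable [IsProbabilityMeasure μ]
  (hWlaw : ∀ i, μ.map (W i) = _root_.stdGaussian s)
  (hWindep : ∀ i : Fin (n + 1),
    IndepFun (W i) (fun ω => (M ω, fun j : Fin (i : ℕ) => W (Fin.castLE i.isLt.le j) ω)) μ)
  (hint : ∀ i, Integrable (fun ω => sqNorm (Φ i ω)) μ)
include hWlaw hWindep hint

/-- The outputs of a Gaussian channel with feedback have a channel density, and its information is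
between half the sums of the causal and the predicted mean square errors. -/
lemma exists_isChannelDensity_feedback (k : ℕ) (hk : k ≤ n + 1) :
    ∃ (ν : Measure (Fin k → (Fin s → ℝ))) (L : α × (Fin k → (Fin s → ℝ)) → ℝ),
      IsProbabilityMeasure ν ∧
      IsChannelDensity μ M (fun ω (j : Fin k) => Y (Fin.castLE hk j) ω) ν L ∧
      1 / 2 * ∑ i : Fin k, cmmseF μ Y (Φ (Fin.castLE hk i)) i
        ≤ channelInfo μ M (fun ω (j : Fin k) => Y (Fin.castLE hk j) ω) L ∧
      channelInfo μ M (fun ω (j : Fin k) => Y (Fin.castLE hk j) ω) L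
        ≤ 1 / 2 * ∑ i : Fin k, pmmseF μ Y (Φ (Fin.castLE hk i)) i := by
  induction k with
  | zero =>
    have := Measure.isProbabilityMeasure_map (μ := μ) hM.aemeasurable
    refine ⟨Measure.dirac Fin.elim0, fun _ => 1, inferInstance,
      ⟨measurable_const, fun _ => one_pos, ?_, by simp⟩, ?_⟩
    · have h : (fun ω => (M ω, fun j : Fin 0 => Y (Fin.castLE hk j) ω))
          = (fun m => (m, (Fin.elim0 : Fin 0 → (Fin s → ℝ)))) ∘ M :=
        funext fun ω => Prod.ext rfl (Subsingleton.elim _ _)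
      rw [h, ← Measure.map_map (by fun_prop) hM, Measure.prod_dirac]
      simp
    · simp [channelInfo, margDens]
  | succ k ih =>
    have hk' : k ≤ n + 1 := Nat.le_of_succ_le hk
    obtain ⟨ν, L, hν, H, hlow, hup⟩ := ih hk'
    obtain ⟨g, hg, hgY⟩ := exists_measurable_history hφ hΦ hY k hk'
    set i : Fin (n + 1) := ⟨k, hk⟩
    set T : Ω → Fin k → (Fin s → ℝ) := fun ω j => Y (Fin.castLE hk' j) ω
    have hT : Measurable T := measurable_history hφ hΦ hY hM hWmeas k hk'
    have hf : Measurable (φ i) := hφ i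
    have hΦi : ∀ ω, Φ i ω = φ i (M ω, T ω) := hΦ i
    have hYi : ∀ ω, Y i ω = φ i (M ω, T ω) + W i ω := fun ω => by rw [hY, hΦi]
    have hind : IndepFun (W i) (fun ω => (M ω, T ω)) μ := by
      have h := (hWindep i).comp (φ := id) (ψ := fun p => (p.1, g p)) measurable_id
        (measurable_fst.prodMk hg)
      have h2 : (fun ω => (M ω, T ω)) = (fun p => (p.1, g p)) ∘
          fun ω => (M ω, fun j : Fin k => W (Fin.castLE hk' j) ω) :=
        funext fun ω => Prod.ext rfl (hgY ω)
      rw [h2]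
      exact h
    have hinti : Integrable (fun ω => sqNorm (φ i (M ω, T ω))) μ := by
      simpa only [hΦi] using hint i
    have H' := H.gaussChannel hM hT hf hinti (hWmeas i) (hWlaw i) hind
    have hI := H.channelInfo_gaussChannel hM hT hf hinti (hWmeas i) (hWlaw i) hind
    simp only [← hΦi, ← hY] at H' hI
    have hTY : Measurable fun ω => (T ω, Y i ω) :=
      hT.prodMk ((funext hYi : Y i = _) ▸ (hf.comp (hM.prodMk hT)).add (hWmeas i))
    set e := snocMeasurableEquiv (Fin s → ℝ) k
    have hsnoc : (fun ω (j : Fin (k + 1)) => Y (Fin.castLE hk j) ω) = fun ω => e (T ω, Y i ω) :=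
      funext fun ω => (snocMeasurableEquiv_eq fun j : Fin (k + 1) => Y (Fin.castLE hk j) ω).symm
    have hσ : MeasurableSpace.comap (fun ω => (T ω, Y i ω)) inferInstance
        = pastSigmaF Y (k + 1) := by
      rw [← comap_history_eq_pastSigmaF Y hk, hsnoc]
      exact (congrArg (MeasurableSpace.comap fun ω => (T ω, Y i ω))
        e.measurableEmbedding.comap_eq).symm.trans MeasurableSpace.comap_comp
    rw [hσ, comap_history_eq_pastSigmaF Y hk'] at hI
    have hprob : IsProbabilityMeasure ((ν.prod (_root_.stdGaussian s)).map e) :=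
      Measure.isProbabilityMeasure_map e.measurable.aemeasurable
    refine ⟨_, _, hprob, hsnoc ▸ H'.measurableEquiv_comp hM hTY e, ?_⟩
    rw [hsnoc, channelInfo_measurableEquiv_comp, Fin.sum_univ_castSucc, Fin.sum_univ_castSucc]
    have hc : cmmseF μ Y (Φ (Fin.castLE hk (Fin.last k))) (Fin.last k : Fin (k + 1))
      = ∫ ω, sqNorm (Φ i ω - (μ[Φ i | pastSigmaF Y (k + 1)]) ω) ∂μ := rfl
    have hp : pmmseF μ Y (Φ (Fin.castLE hk (Fin.last k))) (Fin.last k : Fin (k + 1))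
      = ∫ ω, sqNorm (Φ i ω - (μ[Φ i | pastSigmaF Y k]) ω) ∂μ := rfl
    rw [hc, hp, mul_add, mul_add]
    exact ⟨(add_le_add_left hlow _).trans hI.1, hI.2.trans (add_le_add_left hup _)⟩

end Feedback

/-- **Theorem 2.4 (feedback case).** Discrete-time I-MMSE relationship for the additive
white Gaussian channel with feedback: if `Y_i = φ_i(M, Y_0,…,Y_{i-1}) + W_i` with each `W_i`
standard Gaussian and independent of `(M, W_0,…,W_{i-1})`, then
`(1/2)·∑ cmmse(Φ_i) ≤ I(M; (Y_0,…,Y_n)) ≤ (1/2)·∑ pmmse(Φ_i)`. -/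
theorem total_information_IMMSE_feedback
    {Ω α : Type*} [MeasurableSpace Ω] [MeasurableSpace α] [StandardBorelSpace α]
    (μ : Measure Ω) [IsProbabilityMeasure μ] (s n : ℕ)
    (M : Ω → α) (hM : Measurable M)
    (W : Fin (n + 1) → Ω → (Fin s → ℝ)) (hWmeas : ∀ i, Measurable (W i))
    (hWlaw : ∀ i, μ.map (W i) = stdGaussian s)
    (hWindep : ∀ i : Fin (n + 1),
      IndepFun (W i)
        (fun ω => (M ω, fun j : Fin (i : ℕ) => W (Fin.castLE i.isLt.le j) ω)) μ)
    (φ : (i : Fin (n + 1)) → α × (Fin (i : ℕ) → (Fin s → ℝ)) → (Fin s → ℝ))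
    (hφ : ∀ i, Measurable (φ i))
    (Y : Fin (n + 1) → Ω → (Fin s → ℝ))
    (Φ : Fin (n + 1) → Ω → (Fin s → ℝ))
    (hΦ : ∀ i ω, Φ i ω = φ i (M ω, fun j : Fin (i : ℕ) => Y (Fin.castLE i.isLt.le j) ω))
    (hY : ∀ i ω, Y i ω = Φ i ω + W i ω)
    (hint : ∀ i, Integrable (fun ω => sqNorm (Φ i ω)) μ) :
    ((1 / 2 * ∑ i : Fin (n + 1), cmmseF μ Y (Φ i) i : ℝ) : EReal)
        ≤ mutualInfo μ M (fun ω (i : Fin (n + 1)) => Y i ω) ∧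
      mutualInfo μ M (fun ω (i : Fin (n + 1)) => Y i ω)
        ≤ ((1 / 2 * ∑ i : Fin (n + 1), pmmseF μ Y (Φ i) i : ℝ) : EReal) := by
  obtain ⟨ν, L, hν, H, hlow, hup⟩ := exists_isChannelDensity_feedback hφ hΦ hY hM hWmeas hWlaw
    hWindep hint (n + 1) le_rfl
  have hI := H.mutualInfo_eq hM (measurable_history hφ hΦ hY hM hWmeas (n + 1) le_rfl)
  simp only [Fin.castLE_rfl, id_eq] at hI hlow hup
  rw [hI, EReal.coe_le_coe_iff, EReal.coe_le_coe_iff]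
  exact ⟨hlow, hup⟩

end
end

section
/- Determinant identity for the steady-state algebraic Riccati equation (used in the proof of Proposition 3.6 and footnote observation a): Let A ∈ ℝ^{m×m}, G ∈ ℝ^{s×m}, and let P ∈ ℝ^{m×m} be a symmetric positive-definite matrix satisfying the steady-state Riccati equation P = A (P − P Gᵀ (G P Gᵀ + I_s)⁻¹ G P) Aᵀ. Then A is invertible and det(G P Gᵀ + I_s) = (det A)². -/
open Matrix

theorem isUnit_det_mul_mul_transpose_add_one {m s : ℕ} (G : Matrix (Fin s) (Fin m) ℝ)
    {P : Matrix (Fin m) (Fin m) ℝ} (hP : P.PosSemidef) : IsUnit (G * P * Gᵀ + 1).det := by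
  have h : (G * P * Gᵀ).PosSemidef := by
    simpa only [conjTranspose_eq_transpose_of_trivial] using hP.mul_mul_conjTranspose_same G
  exact (PosDef.posSemidef_add h PosDef.one).det_pos.ne'.isUnit

/-- The determinant of the Kalman measurement update of the covariance `P`. -/
theorem det_sub_mul_inv_mul {R : Type*} [CommRing R] {m s : ℕ}
    (G : Matrix (Fin s) (Fin m) R) (P : Matrix (Fin m) (Fin m) R)
    (hS : IsUnit (G * P * Gᵀ + 1).det) :
    (G * P * Gᵀ + 1).det * (P - P * Gᵀ * (G * P * Gᵀ + 1)⁻¹ * G * P).det = P.det := by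
  set S := G * P * Gᵀ + 1 with hS_def
  have hfactor : P - P * Gᵀ * S⁻¹ * G * P = (1 - P * Gᵀ * (S⁻¹ * G)) * P := by
    simp only [Matrix.sub_mul, Matrix.one_mul, Matrix.mul_assoc]
  have hresidual : S * (1 - S⁻¹ * G * (P * Gᵀ)) = 1 := by
    rw [Matrix.mul_sub, Matrix.mul_one, Matrix.mul_assoc S⁻¹,
      mul_nonsing_inv_cancel_left _ _ hS, ← Matrix.mul_assoc, hS_def, add_sub_cancel_left]
  rw [hfactor, det_mul, det_one_sub_mul_comm, ← mul_assoc, ← det_mul, hresidual, det_one,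
    one_mul]

/-- **Determinant identity for the steady-state algebraic Riccati equation** (used in the
proof of Proposition 3.6): if a symmetric positive-definite `P` satisfies
`P = A (P − P Gᵀ (G P Gᵀ + I)⁻¹ G P) Aᵀ`, then `A` is invertible and
`det (G P Gᵀ + I) = (det A)²`. -/
theorem riccati_det_identity {m s : ℕ}
    (A : Matrix (Fin m) (Fin m) ℝ) (G : Matrix (Fin s) (Fin m) ℝ)
    (P : Matrix (Fin m) (Fin m) ℝ) (hP : P.PosDef)
    (hric : P = A * (P - P * Gᵀ * (G * P * Gᵀ + 1)⁻¹ * G * P) * Aᵀ) :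
    IsUnit A.det ∧ (G * P * Gᵀ + 1).det = A.det ^ 2 := by
  have hS := isUnit_det_mul_mul_transpose_add_one G hP.posSemidef
  have hupdate := det_sub_mul_inv_mul G P hS
  have hdet := congrArg det hric
  rw [det_mul, det_mul, det_transpose] at hdet
  have hidentity : (G * P * Gᵀ + 1).det = A.det ^ 2 := by
    apply mul_right_cancel₀ hP.det_pos.ne'
    linear_combination (G * P * Gᵀ + 1).det * hdet + A.det ^ 2 * hupdate
  exact ⟨(isUnit_pow_iff two_ne_zero).mp (hidentity ▸ hS), hidentity⟩
end

section
/- Steady-state causal and predicted MMSE bounds around the unstable-pole sum (footnote observations b and c of Proposition 3.6, matrix form): Let A ∈ ℝ^{m×m}, G ∈ ℝ^{s×m}, and let P ∈ ℝ^{m×m} be symmetric positive definite satisfying P = A (P − P Gᵀ (G P Gᵀ + I_s)⁻¹ G P) Aᵀ, and define the posterior covariance P⁺ := P − P Gᵀ (G P Gᵀ + I_s)⁻¹ G P. Then tr(G P⁺ Gᵀ) ≤ 2 log|det A| ≤ tr(G P Gᵀ). -/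
open Matrix

/-- The log-determinant of a positive definite real matrix is at most its trace minus its size. -/
theorem Matrix.PosDef.log_det_le_trace_sub_card {n : Type*} [Fintype n] [DecidableEq n]
    {M : Matrix n n ℝ} (hM : M.PosDef) : Real.log M.det ≤ M.trace - Fintype.card n := by
  have hd := hM.isHermitian.det_eq_prod_eigenvalues
  have ht := hM.isHermitian.trace_eq_sum_eigenvalues
  simp only [RCLike.ofReal_real_eq_id, id_eq] at hd ht
  rw [hd, ht, Real.log_prod fun i _ => (hM.eigenvalues_pos i).ne']
  calc ∑ i, Real.log (hM.isHermitian.eigenvalues i)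
      ≤ ∑ i, (hM.isHermitian.eigenvalues i - 1) :=
        Finset.sum_le_sum fun i _ => Real.log_le_sub_one_of_pos (hM.eigenvalues_pos i)
    _ = ∑ i, hM.isHermitian.eigenvalues i - Fintype.card n := by simp

/-- The determinant of a Kalman measurement update, relative to the innovation covariance. -/
theorem Matrix.det_sub_mul_inv_mul_mul_det {m n R : Type*} [Fintype m] [DecidableEq m]
    [Fintype n] [DecidableEq n] [CommRing R] (P : Matrix m m R) (G : Matrix n m R)
    (hK : IsUnit (G * P * Gᵀ + 1).det) :
    (P - P * Gᵀ * (G * P * Gᵀ + 1)⁻¹ * G * P).det * (G * P * Gᵀ + 1).det = P.det := by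
  set K := G * P * Gᵀ + 1 with hKdef
  have hfac : P - P * Gᵀ * K⁻¹ * G * P = P * (1 - Gᵀ * (K⁻¹ * G * P)) := by
    simp only [Matrix.mul_sub, Matrix.mul_one, Matrix.mul_assoc]
  have hinv : 1 - K⁻¹ * G * P * Gᵀ = K⁻¹ := by
    have hGP : G * P * Gᵀ = K - 1 := by rw [hKdef, add_sub_cancel_right]
    rw [Matrix.mul_assoc K⁻¹ G P, Matrix.mul_assoc K⁻¹, hGP, Matrix.mul_sub,
      Matrix.nonsing_inv_mul _ hK, Matrix.mul_one, sub_sub_cancel]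
  rw [hfac, det_mul, det_one_sub_mul_comm, hinv, mul_assoc, ← det_mul,
    Matrix.nonsing_inv_mul _ hK, det_one, mul_one]

/-- The filtered covariance of the signal is `1` minus the inverse innovation covariance. -/
theorem Matrix.mul_sub_mul_inv_mul_mul_transpose {m n R : Type*} [Fintype m]
    [Fintype n] [DecidableEq n] [CommRing R] (P : Matrix m m R) (G : Matrix n m R)
    (hK : IsUnit (G * P * Gᵀ + 1).det) :
    G * (P - P * Gᵀ * (G * P * Gᵀ + 1)⁻¹ * G * P) * Gᵀ = 1 - (G * P * Gᵀ + 1)⁻¹ := by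
  set K := G * P * Gᵀ + 1 with hKdef
  have hGP : G * P * Gᵀ = K - 1 := by rw [hKdef, add_sub_cancel_right]
  calc G * (P - P * Gᵀ * K⁻¹ * G * P) * Gᵀ
      = G * P * Gᵀ - (G * P * Gᵀ) * K⁻¹ * (G * P * Gᵀ) := by
        simp only [Matrix.mul_sub, Matrix.sub_mul, Matrix.mul_assoc]
    _ = 1 - K⁻¹ := by
        rw [hGP, Matrix.sub_mul, Matrix.mul_nonsing_inv _ hK, Matrix.one_mul, Matrix.mul_sub,
          Matrix.mul_one, Matrix.sub_mul, Matrix.one_mul, Matrix.nonsing_inv_mul _ hK]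
        abel

/-- **Steady-state causal and predicted MMSE bounds around the unstable-pole sum**
(footnote observations b and c of Proposition 3.6, matrix form): if the symmetric
positive-definite `P` satisfies the steady-state Riccati equation
`P = A (P − P Gᵀ (G P Gᵀ + I)⁻¹ G P) Aᵀ` and `P⁺ := P − P Gᵀ (G P Gᵀ + I)⁻¹ G P`, then
`tr (G P⁺ Gᵀ) ≤ 2 log |det A| ≤ tr (G P Gᵀ)`. -/
theorem steady_state_mmse_bounds {m s : ℕ}
    (A : Matrix (Fin m) (Fin m) ℝ) (G : Matrix (Fin s) (Fin m) ℝ)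
    (P : Matrix (Fin m) (Fin m) ℝ) (hP : P.PosDef)
    (hric : P = A * (P - P * Gᵀ * (G * P * Gᵀ + 1)⁻¹ * G * P) * Aᵀ) :
    (G * (P - P * Gᵀ * (G * P * Gᵀ + 1)⁻¹ * G * P) * Gᵀ).trace ≤ 2 * Real.log |A.det| ∧
      2 * Real.log |A.det| ≤ (G * P * Gᵀ).trace := by
  have hS : (G * P * Gᵀ).PosSemidef := by
    simpa [conjTranspose_eq_transpose_of_trivial] using hP.posSemidef.mul_mul_conjTranspose_same G
  have hK : (G * P * Gᵀ + 1).PosDef := PosDef.posSemidef_add hS PosDef.one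
  have hu : IsUnit (G * P * Gᵀ + 1).det := hK.det_pos.ne'.isUnit
  have hdet : A.det ^ 2 = (G * P * Gᵀ + 1).det := by
    have hpost := det_sub_mul_inv_mul_mul_det P G hu
    have hpred := congrArg det hric
    rw [det_mul, det_mul, det_transpose] at hpred
    apply mul_right_cancel₀ hP.det_pos.ne'
    linear_combination A.det ^ 2 * (-hpost) - (G * P * Gᵀ + 1).det * hpred
  have hlog : 2 * Real.log |A.det| = Real.log (G * P * Gᵀ + 1).det := by
    rw [← hdet, Real.log_pow, Real.log_abs]
    norm_num
  have hupper := hK.log_det_le_trace_sub_card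
  have hlower := hK.inv.log_det_le_trace_sub_card
  rw [trace_add, trace_one] at hupper
  rw [det_nonsing_inv, Ring.inverse_eq_inv', Real.log_inv] at hlower
  rw [hlog, mul_sub_mul_inv_mul_mul_transpose P G hu, trace_sub, trace_one]
  constructor <;> linarith
end
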